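/- Let β > 1, 0 < s < β + 1/2, δ ∈ ℝ and M > 0. Then there is a constant C = C(s, δ, β, M) such that for every u ∈ H_{s,δ}(ℝ³) ∩ L^∞(ℝ³) with ‖u‖_{L^∞} ≤ M, the function |u|^β belongs to H_{s,δ} and ‖|u|^β‖_{H_{s,δ}} ≤ C ‖u‖_{H_{s,δ}}. -/

import Mathlib

open MeasureTheory Real Set
open scoped FourierTransform ENNReal NNReal

noncomputable section

abbrev E3 : Type := EuclideanSpace ℝ (Fin 3)

/-- A dyadic partition of unity on ℝ³ as in the paper: `ψ j ∈ C_0^∞`, nonnegative,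
`supp ψ₀ ⊆ {|x| ≤ 2}`, `ψ₀ = 1` on `{|x| ≤ 1}`, for `j ≥ 1`
`supp ψ_j ⊆ {2^(j-2) ≤ |x| ≤ 2^(j+1)}`, `ψ_j = 1` on `{2^(j-1) ≤ |x| ≤ 2^j}`, and
`|∂^α ψ_j| ≤ C_α 2^(-|α| j)` with `C_α` independent of `j`. -/
structure DyadicPartition where
  ψ : ℕ → E3 → ℝ
  smooth : ∀ j, ContDiff ℝ (⊤ : ℕ∞) (ψ j)
  nonneg : ∀ j x, 0 ≤ ψ j x
  compSupp : ∀ j, HasCompactSupport (ψ j)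
  supp_zero : ∀ x : E3, ψ 0 x ≠ 0 → ‖x‖ ≤ 2
  one_zero : ∀ x : E3, ‖x‖ ≤ 1 → ψ 0 x = 1
  supp_succ : ∀ j : ℕ, 1 ≤ j → ∀ x : E3, ψ j x ≠ 0 →
    (2:ℝ) ^ ((j:ℤ) - 2) ≤ ‖x‖ ∧ ‖x‖ ≤ (2:ℝ) ^ ((j:ℤ) + 1)
  one_succ : ∀ j : ℕ, 1 ≤ j → ∀ x : E3,
    (2:ℝ) ^ ((j:ℤ) - 1) ≤ ‖x‖ → ‖x‖ ≤ (2:ℝ) ^ (j:ℤ) → ψ j x = 1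
  deriv_bound : ∀ n : ℕ, ∃ C : ℝ, ∀ (j : ℕ) (x : E3),
    ‖iteratedFDeriv ℝ n (ψ j) x‖ ≤ C * (2:ℝ) ^ (-(n:ℤ) * (j:ℤ))

/-- The squared `H^s` norm `∫ (1+|ξ|²)^s |𝓕f(ξ)|² dξ` of a complex-valued function. -/
def HsNormSq (s : ℝ) (f : E3 → ℂ) : ℝ≥0∞ :=
  ∫⁻ ξ : E3, ENNReal.ofReal ((1 + ‖ξ‖ ^ 2) ^ s) * (‖𝓕 f ξ‖₊ : ℝ≥0∞) ^ 2

/-- The squared weighted Sobolev norm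
`‖u‖²_{H_{s,δ}} = Σ_j 2^{(3/2+δ)2j} ‖(ψ_j u)_{2^j}‖²_{H^s}`,
where `(ψ_j u)_{2^j}(x) = ψ_j(2^j x) u(2^j x)`. -/
def HwNormSq (P : DyadicPartition) (s δ : ℝ) (u : E3 → ℝ) : ℝ≥0∞ :=
  ∑' j : ℕ, ENNReal.ofReal ((2:ℝ) ^ ((3 + 2 * δ) * (j:ℝ))) *
    HsNormSq s (fun x : E3 =>
      ((P.ψ j (((2:ℝ) ^ (j:ℕ)) • x) * u (((2:ℝ) ^ (j:ℕ)) • x) : ℝ) : ℂ))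

/-- Membership in the weighted Sobolev space `H_{s,δ}` (for functions). -/
def MemH (P : DyadicPartition) (s δ : ℝ) (u : E3 → ℝ) : Prop :=
  LocallyIntegrable u volume ∧ HwNormSq P s δ u < ⊤

/-- The weighted Sobolev norm `‖u‖_{H_{s,δ}}`. -/
def Hnorm (P : DyadicPartition) (s δ : ℝ) (u : E3 → ℝ) : ℝ :=
  Real.sqrt (HwNormSq P s δ u).toReal

/-- The squared weighted `L²_δ` norm `∫ (1+|x|)^{2δ} |u(x)|² dx`. -/
def L2wNormSq (δ : ℝ) (u : E3 → ℝ) : ℝ≥0∞ :=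
  ∫⁻ x : E3, ENNReal.ofReal ((1 + ‖x‖) ^ (2 * δ)) * (‖u x‖₊ : ℝ≥0∞) ^ 2

/-- The weighted `L²_δ` norm. -/
def L2wNorm (δ : ℝ) (u : E3 → ℝ) : ℝ :=
  Real.sqrt (L2wNormSq δ u).toReal

/-- Membership in `L²_δ`. -/
def MemL2w (δ : ℝ) (u : E3 → ℝ) : Prop :=
  AEStronglyMeasurable u volume ∧ L2wNormSq δ u < ⊤

/-- The partial derivative `∂_a f (x)`. -/
def pd (f : E3 → ℝ) (a : Fin 3) (x : E3) : ℝ :=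
  fderiv ℝ f x (EuclideanSpace.single a 1)

lemma exists_add_rpow_le {p ε : ℝ} (hp : 0 < p) (hε : 0 < ε) :
    ∃ C : ℝ, 0 ≤ C ∧ ∀ x y : ℝ, 0 ≤ x → 0 ≤ y →
      (x + y) ^ p ≤ (1 + ε) * x ^ p + C * y ^ p := by
  have hcont : ContinuousAt (fun t : ℝ => (1 + t) ^ p) 0 := by
    apply ContinuousAt.rpow_const
    · fun_prop
    · right; exact hp.le
  have hev : ∀ᶠ t in nhds (0 : ℝ), (1 + t) ^ p < 1 + ε := by
    apply hcont.eventually_lt_const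
    simpa using hε
  obtain ⟨τ, hτ, hτb⟩ := Metric.eventually_nhds_iff.1 hev
  have hτ2 : (1 + τ / 2) ^ p < 1 + ε := hτb (by
    rw [Real.dist_eq, sub_zero, abs_of_pos (by positivity)]; linarith)
  refine ⟨(2 / τ + 1) ^ p, by positivity, fun x y hx hy => ?_⟩
  rcases le_total y (τ / 2 * x) with h | h
  · calc (x + y) ^ p ≤ ((1 + τ / 2) * x) ^ p := by
          apply Real.rpow_le_rpow (by positivity) _ hp.le; linarith
      _ = (1 + τ / 2) ^ p * x ^ p := Real.mul_rpow (by positivity) hx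
      _ ≤ (1 + ε) * x ^ p := by gcongr
      _ ≤ _ := by have : 0 ≤ (2 / τ + 1) ^ p * y ^ p := by positivity
                  linarith
  · have hx' : x ≤ 2 / τ * y := by
      rw [div_mul_eq_mul_div, le_div_iff₀ hτ]; linarith
    calc (x + y) ^ p ≤ ((2 / τ + 1) * y) ^ p := by
          apply Real.rpow_le_rpow (by positivity) _ hp.le; linarith
      _ = (2 / τ + 1) ^ p * y ^ p := Real.mul_rpow (by positivity) hy
      _ ≤ _ := by have : 0 ≤ (1 + ε) * x ^ p := by positivity
                  linarith

/-- The `p`-th power of the jump from `a` to `b` if this jump crosses zero, and `0` otherwise. -/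
def crossing (p a b : ℝ) : ℝ := if a * b < 0 then |b - a| ^ p else 0

lemma crossing_nonneg (p a b : ℝ) : 0 ≤ crossing p a b := by
  unfold crossing; split_ifs <;> positivity

lemma crossing_le (p a b : ℝ) : crossing p a b ≤ |b - a| ^ p := by
  unfold crossing; split_ifs
  · exact le_rfl
  · positivity

lemma exists_crossing_add_crossing_le {p ε : ℝ} (hp : 0 < p) (hε : 0 < ε) :
    ∃ C : ℝ, 0 ≤ C ∧ ∀ a b c : ℝ,
      crossing p a b + crossing p b c ≤
        (1 + ε) * 2 ^ (-p) * crossing p a c + C * |c - 2 * b + a| ^ p := by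
  obtain ⟨C, hC, hCb⟩ := exists_add_rpow_le hp hε
  refine ⟨2 ^ (-p) * C + 2, by positivity, fun a b c => ?_⟩
  have key : ∀ t, |t| ≤ (|c - a| + |c - 2 * b + a|) / 2 → |t| ^ p ≤
      (1 + ε) * 2 ^ (-p) * |c - a| ^ p + 2 ^ (-p) * C * |c - 2 * b + a| ^ p := by
    intro t ht
    calc |t| ^ p ≤ ((|c - a| + |c - 2 * b + a|) / 2) ^ p := by gcongr
      _ = 2 ^ (-p) * (|c - a| + |c - 2 * b + a|) ^ p := by
        rw [Real.div_rpow (by positivity) (by norm_num), Real.rpow_neg (by norm_num)]; ring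
      _ ≤ 2 ^ (-p) * ((1 + ε) * |c - a| ^ p + C * |c - 2 * b + a| ^ p) := by
        gcongr; exact hCb _ _ (abs_nonneg _) (abs_nonneg _)
      _ = _ := by ring
  have hdp : 0 ≤ |c - 2 * b + a| ^ p := by positivity
  have h1 : |b - a| ≤ (|c - a| + |c - 2 * b + a|) / 2 := by
    have h := abs_sub (c - a) (c - 2 * b + a)
    rw [show c - a - (c - 2 * b + a) = 2 * (b - a) by ring, abs_mul, abs_two] at h
    linarith
  have h2 : |c - b| ≤ (|c - a| + |c - 2 * b + a|) / 2 := by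
    have h := abs_add_le (c - a) (c - 2 * b + a)
    rw [show c - a + (c - 2 * b + a) = 2 * (c - b) by ring, abs_mul, abs_two] at h
    linarith
  by_cases hac : a * c < 0
  · have k1 := key _ h1
    have k2 := key _ h2
    have hX : crossing p a c = |c - a| ^ p := if_pos hac
    rw [hX]
    by_cases hab : a * b < 0
    · have hbc : ¬ b * c < 0 := by
        intro hbc
        have := mul_pos_of_neg_of_neg hab hbc
        nlinarith [mul_self_nonneg b]
      rw [crossing, if_pos hab, crossing, if_neg hbc]
      linarith
    · rw [crossing, if_neg hab, zero_add]
      refine (crossing_le _ _ _).trans ?_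
      linarith
  · have hX : crossing p a c = 0 := if_neg hac
    rw [hX, mul_zero, zero_add]
    suffices h : (a * b < 0 ∨ b * c < 0) →
        |b - a| ≤ |c - 2 * b + a| ∧ |c - b| ≤ |c - 2 * b + a| by
      by_cases hh : a * b < 0 ∨ b * c < 0
      · obtain ⟨u, v⟩ := h hh
        have u' : |b - a| ^ p ≤ |c - 2 * b + a| ^ p := by gcongr
        have v' : |c - b| ^ p ≤ |c - 2 * b + a| ^ p := by gcongr
        have := crossing_le p a b
        have := crossing_le p b c
        have : 0 ≤ 2 ^ (-p) * C * |c - 2 * b + a| ^ p := by positivity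
        linarith
      · push Not at hh
        rw [crossing, if_neg (not_lt.2 hh.1), crossing, if_neg (not_lt.2 hh.2), add_zero]
        positivity
    intro hh
    push Not at hac
    have hsgn : (0 ≤ b - a ∧ c - b ≤ 0) ∨ (b - a ≤ 0 ∧ 0 ≤ c - b) := by
      rcases lt_trichotomy b 0 with hb | hb | hb
      · right
        rcases hh with h | h
        · have ha : 0 < a := by nlinarith
          have hc : 0 ≤ c := by nlinarith
          constructor <;> linarith
        · have hc : 0 < c := by nlinarith
          have ha : 0 ≤ a := by nlinarith
          constructor <;> linarith
      · simp [hb] at hh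
      · left
        rcases hh with h | h
        · have ha : a < 0 := by nlinarith
          have hc : c ≤ 0 := by nlinarith
          constructor <;> linarith
        · have hc : c < 0 := by nlinarith
          have ha : a ≤ 0 := by nlinarith
          constructor <;> linarith
    rcases hsgn with ⟨u, v⟩ | ⟨u, v⟩
    · rw [abs_of_nonneg u, abs_of_nonpos v, abs_of_nonpos (by linarith : c - 2 * b + a ≤ 0)]
      constructor <;> linarith
    · rw [abs_of_nonpos u, abs_of_nonneg v, abs_of_nonneg (by linarith : 0 ≤ c - 2 * b + a)]
      constructor <;> linarith

lemma abs_rpow_le_crossing_add_sum {p : ℝ} (hp : 0 < p) (A : ℕ → ℝ)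
    (hA : |A 8| < 6 * |A 9 - A 8|) :
    |A 9 - A 8| ^ p ≤ crossing p (A 0) (A 16) +
      64 ^ p * ∑ i ∈ Finset.range 15, |A (i + 2) - 2 * A (i + 1) + A i| ^ p := by
  by_cases h : ∃ i ∈ Finset.range 15, |A 9 - A 8| ≤ 64 * |A (i + 2) - 2 * A (i + 1) + A i|
  · obtain ⟨i, hi, hle⟩ := h
    calc |A 9 - A 8| ^ p ≤ (64 * |A (i + 2) - 2 * A (i + 1) + A i|) ^ p := by gcongr
      _ = 64 ^ p * |A (i + 2) - 2 * A (i + 1) + A i| ^ p :=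
        Real.mul_rpow (by norm_num) (abs_nonneg _)
      _ ≤ 64 ^ p * ∑ i ∈ Finset.range 15, |A (i + 2) - 2 * A (i + 1) + A i| ^ p := by
        gcongr
        exact Finset.single_le_sum (f := fun i => |A (i + 2) - 2 * A (i + 1) + A i| ^ p)
          (fun j _ => by positivity) hi
      _ ≤ _ := le_add_of_nonneg_left (crossing_nonneg _ _ _)
  · push Not at h
    have H : ∀ i, i < 15 → 64 * |A (i + 2) - 2 * A (i + 1) + A i| < |A 9 - A 8| :=
      fun i hi => h i (Finset.mem_range.2 hi)
    have hd : ∀ i, i < 15 → 64 * (A (i + 2) - 2 * A (i + 1) + A i) ≤ |A 9 - A 8| ∧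
        -|A 9 - A 8| ≤ 64 * (A (i + 2) - 2 * A (i + 1) + A i) := fun i hi => by
      have h1 := H i hi
      have h2 := abs_le.1 (le_refl |A (i + 2) - 2 * A (i + 1) + A i|)
      constructor <;> linarith [h2.1, h2.2]
    have e0 := hd 0 (by norm_num)
    have e1 := hd 1 (by norm_num)
    have e2 := hd 2 (by norm_num)
    have e3 := hd 3 (by norm_num)
    have e4 := hd 4 (by norm_num)
    have e5 := hd 5 (by norm_num)
    have e6 := hd 6 (by norm_num)
    have e7 := hd 7 (by norm_num)
    have e8 := hd 8 (by norm_num)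
    have e9 := hd 9 (by norm_num)
    have e10 := hd 10 (by norm_num)
    have e11 := hd 11 (by norm_num)
    have e12 := hd 12 (by norm_num)
    have e13 := hd 13 (by norm_num)
    have e14 := hd 14 (by norm_num)
    norm_num only at e0 e1 e2 e3 e4 e5 e6 e7 e8 e9 e10 e11 e12 e13 e14
    have ha := abs_lt.1 hA
    have hcr : A 0 * A 16 < 0 ∧ |A 9 - A 8| ≤ |A 16 - A 0| := by
      rcases le_total 0 (A 9 - A 8) with hb | hb
      · rw [abs_of_nonneg hb] at *
        have f0 : A 0 < 0 := by linarith
        have f1 : 0 < A 16 := by linarith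
        have f2 : A 9 - A 8 ≤ A 16 - A 0 := by linarith
        exact ⟨mul_neg_of_neg_of_pos f0 f1, f2.trans (le_abs_self _)⟩
      · rw [abs_of_nonpos hb] at *
        have f0 : 0 < A 0 := by linarith
        have f1 : A 16 < 0 := by linarith
        have f2 : -(A 9 - A 8) ≤ -(A 16 - A 0) := by linarith
        exact ⟨mul_neg_of_pos_of_neg f0 f1, f2.trans (neg_le_abs _)⟩
    calc |A 9 - A 8| ^ p ≤ |A 16 - A 0| ^ p :=
        Real.rpow_le_rpow (abs_nonneg _) hcr.2 hp.le
      _ = crossing p (A 0) (A 16) := (if_pos hcr.1).symm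
      _ ≤ _ := le_add_of_nonneg_right (by positivity)

/-- The size of the contribution of a nearly linear zero: `|b|^β` damped by
`(|b| / (|a| + |b|))^(L - β)`. -/
def damped (β : ℝ) (L : ℕ) (a b : ℝ) : ℝ := |b| ^ L * (|a| + |b|) ^ (β - L)

lemma damped_nonneg (β : ℝ) (L : ℕ) (a b : ℝ) : 0 ≤ damped β L a b := by
  unfold damped; positivity

lemma damped_le {β : ℝ} {L : ℕ} (hβ : 0 < β) (hL : β < L) (a b : ℝ) :
    damped β L a b ≤ |b| ^ β := by
  unfold damped
  have hL0 : L ≠ 0 := by rintro rfl; simp at hL; linarith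
  rcases eq_or_ne b 0 with rfl | hb
  · simp [hL0, Real.zero_rpow hβ.ne']
  · have hb' : 0 < |b| := abs_pos.2 hb
    calc |b| ^ L * (|a| + |b|) ^ (β - L) ≤ |b| ^ L * |b| ^ (β - L) := by
          gcongr ?_ * ?_
          apply Real.rpow_le_rpow_of_nonpos hb' (by linarith [abs_nonneg a]) (by linarith)
      _ = |b| ^ β := by
        rw [← Real.rpow_natCast, ← Real.rpow_add hb']; congr 1; ring

lemma damped_mono {β : ℝ} {L : ℕ} (hβ : 0 < β) (hL : β < L) (a : ℝ) {b c : ℝ}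
    (h : |b| ≤ |c|) : damped β L a b ≤ damped β L a c := by
  have hL0 : L ≠ 0 := by rintro rfl; simp at hL; linarith
  rcases eq_or_ne b 0 with rfl | hb
  · have : damped β L a 0 = 0 := by simp [damped, hL0]
    rw [this]; exact damped_nonneg _ _ _ _
  have hb' : 0 < |b| := abs_pos.2 hb
  have hc' : 0 < |c| := hb'.trans_le h
  have key : ∀ t : ℝ, 0 < t → t ^ L * (|a| + t) ^ (β - L) = (t / (|a| + t)) ^ L * (|a| + t) ^ β := by
    intro t ht
    have : 0 < |a| + t := by positivity
    rw [Real.rpow_sub this, Real.rpow_natCast, div_pow]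
    ring
  unfold damped
  rw [key _ hb', key _ hc']
  have hq : |b| / (|a| + |b|) ≤ |c| / (|a| + |c|) := by
    rw [div_le_div_iff₀ (by positivity) (by positivity)]
    nlinarith [abs_nonneg a]
  gcongr

lemma damped_const_mul_le {β : ℝ} {L : ℕ} (hβ : 0 < β) (hL : β < L) (a b : ℝ) {c : ℝ}
    (hc : 1 ≤ c) : damped β L a (c * b) ≤ c ^ L * damped β L a b := by
  have hL0 : L ≠ 0 := by rintro rfl; simp at hL; linarith
  rcases eq_or_ne b 0 with rfl | hb
  · simp [damped, hL0]
  have hb' : 0 < |b| := abs_pos.2 hb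
  unfold damped
  rw [abs_mul, abs_of_nonneg (by linarith : 0 ≤ c), mul_pow, mul_assoc]
  gcongr _ * (_ * ?_)
  apply Real.rpow_le_rpow_of_nonpos (by positivity) _ (by linarith)
  nlinarith

lemma damped_le_of_second_diff_small {β : ℝ} {L : ℕ} (hβ : 0 < β) (hL : β < L)
    {a b d : ℝ} (hab : 6 * |b| ≤ |a|) (hd : 64 * |d| < |b|) :
    damped β L a b ≤ (37 / 25 : ℝ)⁻¹ ^ L * damped β L a (2 * b + d) := by
  have hb : 0 < |b| := lt_of_le_of_lt (by positivity) hd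
  have hu : |2 * b + d| ≤ 3 * |b| := by
    have := abs_add_le (2 * b) d
    rw [abs_mul, abs_two] at this; linarith
  have hl : 127 / 64 * |b| ≤ |2 * b + d| := by
    have := abs_sub_abs_le_abs_sub (2 * b) (-d)
    rw [abs_mul, abs_two, abs_neg, sub_neg_eq_add] at this; linarith
  have ha : 0 < |a| := by linarith
  unfold damped
  have h1 : (|a| + |b|) ^ (β - L) ≤ (4 / 3) ^ L * (|a| + |2 * b + d|) ^ (β - L) := by
    calc (|a| + |b|) ^ (β - L) ≤ (3 / 4 * (|a| + |2 * b + d|)) ^ (β - L) := by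
          apply Real.rpow_le_rpow_of_nonpos (by positivity) _ (by linarith)
          linarith
      _ = (3 / 4) ^ (β - L) * (|a| + |2 * b + d|) ^ (β - L) :=
          Real.mul_rpow (by norm_num) (by positivity)
      _ ≤ _ := by
        gcongr
        rw [← Real.rpow_natCast, show (4 / 3 : ℝ) = (3 / 4)⁻¹ by norm_num,
          Real.inv_rpow (by norm_num), ← Real.rpow_neg (by norm_num)]
        apply Real.rpow_le_rpow_of_exponent_ge (by norm_num) (by norm_num)
        linarith
  calc |b| ^ L * (|a| + |b|) ^ (β - L)
      ≤ (64 / 127 * |2 * b + d|) ^ L * ((4 / 3) ^ L * (|a| + |2 * b + d|) ^ (β - L)) := by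
        gcongr; linarith
    _ = (64 / 127 * (4 / 3)) ^ L * (|2 * b + d| ^ L * (|a| + |2 * b + d|) ^ (β - L)) := by
        rw [mul_pow, mul_pow]; ring
    _ ≤ _ := by
        gcongr; norm_num

lemma damped_sq_le {β : ℝ} {L : ℕ} (hβ : 0 < β) (hL : β < L) (A : ℕ → ℝ) :
    damped β L (A 8) (A 9 - A 8) ^ 2 ≤
      ((37 / 25 : ℝ)⁻¹ ^ L) ^ 2 * damped β L (A 8) (A 10 - A 8) ^ 2 +
      crossing (2 * β) (A 0) (A 16) +
      64 ^ (2 * β) * ∑ i ∈ Finset.range 15, |A (i + 2) - 2 * A (i + 1) + A i| ^ (2 * β) := by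
  have hp : 0 < 2 * β := by linarith
  have hsq : damped β L (A 8) (A 9 - A 8) ^ 2 ≤ |A 9 - A 8| ^ (2 * β) := by
    calc _ ≤ (|A 9 - A 8| ^ β) ^ 2 := by
          gcongr
          · exact damped_nonneg _ _ _ _
          · exact damped_le hβ hL _ _
      _ = _ := by rw [← Real.rpow_natCast, ← Real.rpow_mul (abs_nonneg _)]; congr 1; ring
  have hn : 0 ≤ ((37 / 25 : ℝ)⁻¹ ^ L) ^ 2 * damped β L (A 8) (A 10 - A 8) ^ 2 := by positivity
  have hcr := crossing_nonneg (2 * β) (A 0) (A 16)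
  have hs : 0 ≤ 64 ^ (2 * β) *
    ∑ i ∈ Finset.range 15, |A (i + 2) - 2 * A (i + 1) + A i| ^ (2 * β) := by positivity
  rcases lt_or_ge |A 8| (6 * |A 9 - A 8|) with h | h
  · have := abs_rpow_le_crossing_add_sum hp A h
    linarith
  · rcases lt_or_ge (64 * |A 10 - 2 * A 9 + A 8|) |A 9 - A 8| with hd | hd
    · have := damped_le_of_second_diff_small hβ hL h hd
      rw [show 2 * (A 9 - A 8) + (A 10 - 2 * A 9 + A 8) = A 10 - A 8 by ring] at this
      have := pow_le_pow_left₀ (damped_nonneg _ _ _ _) this 2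
      rw [mul_pow] at this
      linarith
    · have h1 : |A 9 - A 8| ^ (2 * β) ≤ 64 ^ (2 * β) * |A 10 - 2 * A 9 + A 8| ^ (2 * β) := by
        rw [← Real.mul_rpow (by norm_num) (abs_nonneg _)]; gcongr
      have h2 := Finset.single_le_sum
          (f := fun i => |A (i + 2) - 2 * A (i + 1) + A i| ^ (2 * β))
          (fun j _ => by positivity) (show 8 ∈ Finset.range 15 by simp)
      have h3 : (64 : ℝ) ^ (2 * β) * |A 10 - 2 * A 9 + A 8| ^ (2 * β) ≤ 64 ^ (2 * β) *
        ∑ i ∈ Finset.range 15, |A (i + 2) - 2 * A (i + 1) + A i| ^ (2 * β) := by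
        gcongr
      linarith

section

open fwdDiff Polynomial

lemma exists_polynomial_approx_one_add_rpow (β : ℝ) {L : ℕ} (hL : 0 < L) :
    ∃ q : ℝ[X], q.natDegree ≤ L - 1 ∧ ∃ r : ℝ, 0 < r ∧ r ≤ 1 / 2 ∧ ∃ C : ℝ, 0 ≤ C ∧
      ∀ z : ℝ, |z| ≤ r → |(1 + z) ^ β - q.eval z| ≤ C * |z| ^ L := by
  have h := (Real.one_add_rpow_hasFPowerSeriesAt_zero (a := β)).isBigO_sub_partialSum_pow L
  obtain ⟨C, hC, hb⟩ := h.exists_nonneg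
  rw [Asymptotics.isBigOWith_iff] at hb
  obtain ⟨r, hr, hrb⟩ := Metric.eventually_nhds_iff.1 hb
  set p := binomialSeries ℝ β
  refine ⟨∑ k ∈ Finset.range L, Polynomial.monomial k (p.coeff k), ?_, min (r / 2) (1 / 2),
    by positivity, min_le_right _ _, C, hC, fun z hz => ?_⟩
  · apply Polynomial.natDegree_sum_le_of_forall_le
    intro i hi
    refine (Polynomial.natDegree_monomial_le _).trans ?_
    have := Finset.mem_range.1 hi
    omega
  · have := hrb (y := z) (by
      rw [Real.dist_eq, sub_zero]
      have := hz.trans (min_le_left _ _)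
      linarith)
    simp only [zero_add, Real.norm_eq_abs, abs_pow, abs_abs] at this
    convert this using 3
    rw [Polynomial.eval_finsetSum, FormalMultilinearSeries.partialSum]
    refine Finset.sum_congr rfl fun k _ => ?_
    rw [FormalMultilinearSeries.apply_eq_pow_smul_coeff, Polynomial.eval_monomial, smul_eq_mul,
      mul_comm]

lemma abs_abs_rpow_sub_abs_rpow_le {β R a b : ℝ} (hβ : 1 ≤ β) (ha : |a| ≤ R) (hb : |b| ≤ R) :
    |(|a| ^ β - |b| ^ β)| ≤ β * R ^ (β - 1) * |a - b| := by
  have hR : 0 ≤ R := (abs_nonneg a).trans ha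
  have h := (convex_Icc (0 : ℝ) R).norm_image_sub_le_of_norm_hasDerivWithin_le
    (f := fun x => x ^ β) (f' := fun x => β * x ^ (β - 1)) (C := β * R ^ (β - 1))
    (fun x _ => (Real.hasDerivAt_rpow_const (Or.inr hβ)).hasDerivWithinAt) (fun x hx => by
      rw [Real.norm_of_nonneg (mul_nonneg (by linarith) (Real.rpow_nonneg hx.1 _))]
      have := Real.rpow_le_rpow hx.1 hx.2 (by linarith : 0 ≤ β - 1)
      gcongr) ⟨abs_nonneg b, hb⟩ ⟨abs_nonneg a, ha⟩
  rw [Real.norm_eq_abs, Real.norm_eq_abs] at h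
  refine h.trans (mul_le_mul_of_nonneg_left (abs_abs_sub_abs_le a b) (by positivity))

lemma abs_fwdDiff_iter_le {E : Type*} [AddCommMonoid E] (h : E) (N : ℕ) (B : E → ℝ) (x : E) :
    |Δ_[h] ^[N] B x| ≤ 2 ^ N * ∑ k ∈ Finset.range (N + 1), |B (x + k • h)| := by
  rw [fwdDiff_iter_eq_sum_shift]
  refine (Finset.abs_sum_le_sum_abs _ _).trans ?_
  rw [Finset.mul_sum]
  refine Finset.sum_le_sum fun k hk => ?_
  rw [zsmul_eq_mul, abs_mul]
  gcongr
  push_cast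
  rw [abs_mul, abs_pow, abs_neg, abs_one, one_pow, one_mul, Nat.abs_cast]
  exact_mod_cast Nat.choose_le_two_pow N k

lemma abs_fwdDiff_iter_le_of_le {N : ℕ} {B : ℕ → ℝ} {R : ℝ} (hB : ∀ n ≤ N, |B n| ≤ R) :
    |Δ_[1] ^[N] B 0| ≤ 2 ^ N * ((N + 1) * R) := by
  refine (abs_fwdDiff_iter_le 1 N B 0).trans ?_
  gcongr
  calc _ ≤ ∑ k ∈ Finset.range (N + 1), R := Finset.sum_le_sum fun k hk => by
        simpa using hB k (by have := Finset.mem_range.1 hk; omega)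
    _ = _ := by simp

lemma fwdDiff_iter_eval_natCast_eq_zero {P : ℝ[X]} {N : ℕ} (hP : P.natDegree < N) :
    Δ_[1] ^[N] (fun n : ℕ => P.eval (n : ℝ)) 0 = 0 := by
  have := congrFun (Polynomial.fwdDiff_iter_eq_zero_of_degree_lt hP) 0
  rw [fwdDiff_iter_eq_sum_shift] at this ⊢
  simpa using this

lemma exists_abs_fwdDiff_abs_add_rpow_le {β : ℝ} (hβ : 0 < β) {L D N : ℕ} (hL : β < L)
    (hN : (L - 1) * D < N) : ∃ C : ℝ, 0 ≤ C ∧ ∀ (a S : ℝ) (P : ℝ[X]), P.natDegree ≤ D → 0 ≤ S →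
      (∀ n ≤ N, |P.eval (n : ℝ)| ≤ S) →
      |Δ_[1] ^[N] (fun n : ℕ => |a + P.eval (n : ℝ)| ^ β) 0| ≤ C * damped β L a S := by
  have hL0 : 0 < L := by
    have : (0 : ℝ) < L := hβ.trans hL
    exact_mod_cast this
  obtain ⟨q, hq, r, hr, hr2, C, hC, hqb⟩ := exists_polynomial_approx_one_add_rpow β hL0
  refine ⟨2 ^ N * ((N + 1) * (C * 2 ^ (L - β) + (2 / r) ^ L)), by positivity,
    fun a S P hP hS hPS => ?_⟩
  have hd := damped_nonneg β L a S
  rcases lt_or_ge S (r * |a|) with h | h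
  · have ha : 0 < |a| := by
      by_contra hneg
      have : |a| = 0 := le_antisymm (not_lt.1 hneg) (abs_nonneg a)
      rw [this] at h; linarith
    have ha0 : a ≠ 0 := abs_pos.1 ha
    set Q : ℝ[X] := Polynomial.C (|a| ^ β) * q.comp (Polynomial.C a⁻¹ * P)
    have hQ : Q.natDegree < N := by
      refine lt_of_le_of_lt ?_ hN
      refine (Polynomial.natDegree_C_mul_le _ _).trans (Polynomial.natDegree_comp_le.trans ?_)
      gcongr
      exact (Polynomial.natDegree_C_mul_le _ _).trans hP
    have hz := fwdDiff_iter_eval_natCast_eq_zero hQ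
    have hsum : Δ_[1] ^[N] (fun n : ℕ => |a + P.eval (n : ℝ)| ^ β) 0 =
        Δ_[1] ^[N] (fun n : ℕ => |a + P.eval (n : ℝ)| ^ β - Q.eval (n : ℝ)) 0 := by
      have : (fun n : ℕ => |a + P.eval (n : ℝ)| ^ β) =
        (fun n : ℕ => |a + P.eval (n : ℝ)| ^ β - Q.eval (n : ℝ)) +
          (fun n : ℕ => Q.eval (n : ℝ)) := by ext; simp
      rw [this, fwdDiff_iter_add, Pi.add_apply, hz, add_zero]
    rw [hsum]
    have hmain : ∀ n ≤ N, |(|a + P.eval (n : ℝ)| ^ β - Q.eval (n : ℝ))| ≤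
        C * 2 ^ (L - β) * damped β L a S := by
      intro n hn
      have hzr : |P.eval (n : ℝ) / a| ≤ S / |a| := by
        rw [abs_div]; gcongr; exact hPS n hn
      have hSr : S / |a| ≤ r := by rw [div_le_iff₀ ha]; exact h.le
      have hz1 := hqb _ (hzr.trans hSr)
      have hpos : 0 ≤ 1 + P.eval (n : ℝ) / a := by
        have := (abs_le.1 (hzr.trans hSr)).1; linarith
      have e1 : |a + P.eval (n : ℝ)| ^ β = |a| ^ β * (1 + P.eval (n : ℝ) / a) ^ β := by
        have : a + P.eval (n : ℝ) = a * (1 + P.eval (n : ℝ) / a) := by field_simp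
        rw [this, abs_mul, abs_of_nonneg hpos, Real.mul_rpow (abs_nonneg _) hpos]
      have e2 : Q.eval (n : ℝ) = |a| ^ β * q.eval (P.eval (n : ℝ) / a) := by
        simp only [Q, Polynomial.eval_mul, Polynomial.eval_C, Polynomial.eval_comp]
        congr 2; field_simp
      rw [e1, e2, ← mul_sub, abs_mul, abs_of_nonneg (by positivity : 0 ≤ |a| ^ β)]
      calc |a| ^ β * |(1 + P.eval (n : ℝ) / a) ^ β - q.eval (P.eval (n : ℝ) / a)|
          ≤ |a| ^ β * (C * (S / |a|) ^ L) := by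
            gcongr
            refine hz1.trans ?_
            gcongr
        _ = C * (S ^ L * |a| ^ (β - L)) := by
            rw [Real.rpow_sub ha, Real.rpow_natCast, div_pow]; ring
        _ ≤ C * (S ^ L * ((|a| + |S|) / 2) ^ (β - L)) := by
            gcongr C * (_ * ?_)
            apply Real.rpow_le_rpow_of_nonpos (by positivity) _ (by linarith)
            rw [abs_of_nonneg hS]
            nlinarith
        _ = C * 2 ^ (L - β) * damped β L a S := by
            rw [damped, abs_of_nonneg hS, Real.div_rpow (by positivity) (by norm_num),
              show β - L = -(L - β) by ring, Real.rpow_neg (x := 2) (by norm_num)]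
            field_simp
    refine (abs_fwdDiff_iter_le_of_le hmain).trans ?_
    rw [mul_assoc (2 ^ N), mul_assoc ((N : ℝ) + 1), add_mul (C * 2 ^ (L - β))]
    gcongr 2 ^ N * (_ * ?_)
    have : 0 ≤ (2 / r) ^ L * damped β L a S := by positivity
    linarith
  · have hmain : ∀ n ≤ N, |(|a + P.eval (n : ℝ)| ^ β)| ≤ (2 / r) ^ L * damped β L a S := by
      intro n hn
      rw [abs_of_nonneg (by positivity)]
      have h1 : |a + P.eval (n : ℝ)| ≤ |a| + S := (abs_add_le _ _).trans (by gcongr; exact hPS n hn)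
      refine (Real.rpow_le_rpow (abs_nonneg _) h1 hβ.le).trans ?_
      rcases (by positivity : 0 ≤ |a| + S).eq_or_lt with h0 | h0
      · rw [← h0, Real.zero_rpow hβ.ne']; positivity
      · rw [damped, abs_of_nonneg hS, ← mul_assoc, ← mul_pow]
        calc (|a| + S) ^ β = (|a| + S) ^ L * (|a| + S) ^ (β - L) := by
              rw [← Real.rpow_natCast, ← Real.rpow_add h0]; congr 1; ring
          _ ≤ _ := by
              gcongr
              rw [div_mul_eq_mul_div, le_div_iff₀ hr]
              nlinarith
    refine (abs_fwdDiff_iter_le_of_le hmain).trans ?_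
    rw [mul_assoc (2 ^ N), mul_assoc ((N : ℝ) + 1), add_mul (C * 2 ^ (L - β))]
    gcongr 2 ^ N * (_ * ?_)
    have : 0 ≤ C * 2 ^ (L - β) * damped β L a S := by positivity
    linarith

lemma exists_abs_fwdDiff_abs_rpow_le {β M : ℝ} (hβ : 1 < β) (hM : 0 ≤ M) {K L N : ℕ}
    (hK : 2 ≤ K) (hL : β < L) (hN : (L - 1) * (K - 1) < N) (hKN : K ≤ N) :
    ∃ C : ℝ, 0 ≤ C ∧ ∀ A : ℕ → ℝ, (∀ n, |A n| ≤ M) →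
      |Δ_[1] ^[N] (fun n => |A n| ^ β) 0| ≤
        C * (∑ k ∈ Finset.Ico K (N + 1), |Δ_[1] ^[k] A 0| +
          ∑ k ∈ Finset.Ico 2 K, |Δ_[1] ^[k] A 0| ^ β + damped β L (A 0) (Δ_[1] ^[1] A 0)) := by
  have hβ0 : 0 < β := by linarith
  obtain ⟨C₁, hC₁, h₁⟩ := exists_abs_fwdDiff_abs_add_rpow_le hβ0 hL hN
  set R : ℝ := M + 2 ^ N * (N * (2 ^ N * ((N + 1) * M))) with hRdef
  set c : ℝ := 2 * 2 ^ N with hcdef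
  have hc1 : 1 ≤ c := by
    have := one_le_pow₀ (by norm_num : (1 : ℝ) ≤ 2) (n := N)
    linarith
  refine ⟨2 ^ N * ((N + 1) * (β * R ^ (β - 1) * 2 ^ N)) +
    C₁ * (c ^ L * ((K : ℝ) ^ (β - 1) + 1)), by positivity, fun A hA => ?_⟩
  set d : ℕ → ℝ := fun k => Δ_[1] ^[k] A 0 with hd
  have hdk : ∀ k ≤ N, |d k| ≤ 2 ^ N * ((N + 1) * M) := by
    intro k hk
    refine (abs_fwdDiff_iter_le_of_le (fun n _ => hA n)).trans ?_
    gcongr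
    norm_num
  set P : ℝ[X] := ∑ k ∈ Finset.Ico 1 K, Polynomial.C (d k / k.factorial) * descPochhammer ℝ k
  have hPn : ∀ n : ℕ, P.eval (n : ℝ) = ∑ k ∈ Finset.Ico 1 K, (n.choose k : ℝ) * d k := by
    intro n
    rw [Polynomial.eval_finsetSum]
    refine Finset.sum_congr rfl fun k _ => ?_
    rw [Polynomial.eval_mul, Polynomial.eval_C, Nat.cast_choose_eq_descPochhammer_div]
    ring
  have hPdeg : P.natDegree ≤ K - 1 := by
    apply Polynomial.natDegree_sum_le_of_forall_le
    intro i hi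
    refine (Polynomial.natDegree_C_mul_le _ _).trans ?_
    rw [descPochhammer_natDegree]
    have := Finset.mem_Ico.1 hi
    omega
  have hchoose : ∀ n ≤ N, ∀ k, (n.choose k : ℝ) ≤ 2 ^ N := by
    intro n hn k
    calc (n.choose k : ℝ) ≤ 2 ^ n := by exact_mod_cast Nat.choose_le_two_pow n k
      _ ≤ 2 ^ N := pow_le_pow_right₀ (by norm_num) hn
  have hbound : ∀ (s : Finset ℕ), ∀ n ≤ N, |∑ k ∈ s, (n.choose k : ℝ) * d k| ≤
      2 ^ N * ∑ k ∈ s, |d k| := by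
    intro s n hn
    refine (Finset.abs_sum_le_sum_abs _ _).trans ?_
    rw [Finset.mul_sum]
    refine Finset.sum_le_sum fun k _ => ?_
    rw [abs_mul, Nat.abs_cast]
    gcongr
    exact hchoose n hn k
  have hnewton : ∀ n ≤ N, A n = A 0 + P.eval (n : ℝ) +
      ∑ k ∈ Finset.Ico K (N + 1), (n.choose k : ℝ) * d k := by
    intro n hn
    have h1 : A n = ∑ k ∈ Finset.range (N + 1), (n.choose k : ℝ) * d k := by
      have := shift_eq_sum_fwdDiff_iter 1 A n 0
      simp only [smul_eq_mul, mul_one, zero_add, nsmul_eq_mul] at this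
      rw [this]
      apply Finset.sum_subset (Finset.range_mono (by omega))
      intro k _ hk
      rw [Nat.choose_eq_zero_of_lt (by simpa using hk)]; simp
    rw [h1, hPn, Finset.range_eq_Ico, ← Finset.sum_Ico_consecutive _ (Nat.zero_le 1) (by omega),
      ← Finset.sum_Ico_consecutive _ (by omega : 1 ≤ K) (by omega)]
    simp [hd]
    ring
  set e : ℝ := ∑ k ∈ Finset.Ico 2 K, |d k| with he
  set t : ℝ := ∑ k ∈ Finset.Ico K (N + 1), |d k| with ht
  have he0 : 0 ≤ e := by positivity
  have ht0 : 0 ≤ t := by positivity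
  have hsplit : ∑ k ∈ Finset.Ico 1 K, |d k| = |d 1| + e := by
    rw [Finset.sum_eq_sum_Ico_succ_bot (by omega)]
  have hR : ∀ n ≤ N, |A 0 + P.eval (n : ℝ)| ≤ R := by
    intro n hn
    refine (abs_add_le _ _).trans ?_
    rw [hPn]
    refine add_le_add (hA 0) ((hbound _ n hn).trans ?_)
    gcongr
    calc ∑ k ∈ Finset.Ico 1 K, |d k| ≤ ∑ k ∈ Finset.Ico 1 K, 2 ^ N * ((N + 1) * M) :=
          Finset.sum_le_sum fun k hk => hdk k (by have := Finset.mem_Ico.1 hk; omega)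
      _ = (K - 1 : ℕ) * (2 ^ N * ((N + 1) * M)) := by simp
      _ ≤ _ := by
        gcongr
        omega
  have hMR : M ≤ R := by
    have : 0 ≤ 2 ^ N * (N * (2 ^ N * ((N + 1) * M))) := by positivity
    linarith
  have hA1 : |Δ_[1] ^[N] (fun n => |A n| ^ β - |A 0 + P.eval (n : ℝ)| ^ β) 0| ≤
      2 ^ N * ((N + 1) * (β * R ^ (β - 1) * 2 ^ N * t)) := by
    apply abs_fwdDiff_iter_le_of_le
    intro n hn
    refine (abs_abs_rpow_sub_abs_rpow_le hβ.le ((hA n).trans hMR) (hR n hn)).trans ?_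
    rw [mul_assoc (β * _)]
    gcongr
    rw [hnewton n hn, add_sub_cancel_left]
    exact hbound _ n hn
  have hA2 : |Δ_[1] ^[N] (fun n : ℕ => |A 0 + P.eval (n : ℝ)| ^ β) 0| ≤
      C₁ * damped β L (A 0) (2 ^ N * (|d 1| + e)) := by
    refine h₁ _ _ P hPdeg (by positivity) fun n hn => ?_
    rw [hPn, ← hsplit]
    exact hbound _ n hn
  have hdamp : damped β L (A 0) (2 ^ N * (|d 1| + e)) ≤
      c ^ L * (damped β L (A 0) (d 1) + damped β L (A 0) e) := by
    rcases le_total |d 1| e with h | h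
    · calc _ ≤ damped β L (A 0) (c * e) := damped_mono hβ0 hL _ (by
            rw [abs_of_nonneg (by positivity : 0 ≤ 2 ^ N * (|d 1| + e)),
              abs_of_nonneg (by positivity : 0 ≤ c * e), hcdef]
            nlinarith [pow_pos (by norm_num : (0 : ℝ) < 2) N])
        _ ≤ c ^ L * damped β L (A 0) e := damped_const_mul_le hβ0 hL _ _ hc1
        _ ≤ _ := by
          gcongr
          linarith [damped_nonneg β L (A 0) (d 1)]
    · calc _ ≤ damped β L (A 0) (c * d 1) := damped_mono hβ0 hL _ (by
            rw [abs_of_nonneg (by positivity : 0 ≤ 2 ^ N * (|d 1| + e)), abs_mul,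
              abs_of_nonneg (by positivity : 0 ≤ c), hcdef]
            nlinarith [pow_pos (by norm_num : (0 : ℝ) < 2) N])
        _ ≤ c ^ L * damped β L (A 0) (d 1) := damped_const_mul_le hβ0 hL _ _ hc1
        _ ≤ _ := by
          gcongr
          linarith [damped_nonneg β L (A 0) e]
  have hde : damped β L (A 0) e ≤ (K : ℝ) ^ (β - 1) * ∑ k ∈ Finset.Ico 2 K, |d k| ^ β := by
    refine (damped_le hβ0 hL _ _).trans ?_
    rw [abs_of_nonneg he0]
    refine (Real.rpow_sum_le_const_mul_sum_rpow _ _ hβ.le).trans ?_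
    gcongr
    simp
  have hsum : Δ_[1] ^[N] (fun n => |A n| ^ β) 0 =
      Δ_[1] ^[N] (fun n => |A n| ^ β - |A 0 + P.eval (n : ℝ)| ^ β) 0 +
      Δ_[1] ^[N] (fun n : ℕ => |A 0 + P.eval (n : ℝ)| ^ β) 0 := by
    have : (fun n => |A n| ^ β) = (fun n => |A n| ^ β - |A 0 + P.eval (n : ℝ)| ^ β) +
      (fun n : ℕ => |A 0 + P.eval (n : ℝ)| ^ β) := by ext; simp
    rw [← Pi.add_apply, ← fwdDiff_iter_add, ← this]
  rw [hsum]
  refine (abs_add_le _ _).trans ((add_le_add hA1 hA2).trans ?_)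
  set E := ∑ k ∈ Finset.Ico 2 K, |d k| ^ β with hE
  have hE0 : 0 ≤ E := by positivity
  have hD0 := damped_nonneg β L (A 0) (d 1)
  set D := damped β L (A 0) (d 1) with hD
  set κ := (K : ℝ) ^ (β - 1) with hκ
  have hκ0 : 0 ≤ κ := by positivity
  have hR0 : 0 ≤ R := hM.trans hMR
  set a₁ := 2 ^ N * ((N + 1) * (β * R ^ (β - 1) * 2 ^ N)) with ha₁
  have ha₁0 : 0 ≤ a₁ := by positivity
  calc 2 ^ N * ((N + 1) * (β * R ^ (β - 1) * 2 ^ N * t)) +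
        C₁ * damped β L (A 0) (2 ^ N * (|d 1| + e))
      ≤ a₁ * t + C₁ * (c ^ L * (D + κ * E)) := by
        refine add_le_add (le_of_eq (by rw [ha₁]; ring)) ?_
        gcongr
        exact hdamp.trans (by gcongr)
    _ ≤ a₁ * (t + E + D) + C₁ * (c ^ L * ((κ + 1) * (t + E + D))) := by
        gcongr
        · linarith
        · nlinarith [mul_nonneg hκ0 ht0, mul_nonneg hκ0 hD0]
    _ = _ := by ring

lemma fwdDiff_iter_apply_eq_seq {E : Type*} [AddCommMonoid E] (h : E) (f : E → ℝ) (k : ℕ) (x : E) :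
    Δ_[h] ^[k] f x = Δ_[1] ^[k] (fun n : ℕ => f (x + n • h)) 0 := by
  rw [fwdDiff_iter_eq_sum_shift, fwdDiff_iter_eq_sum_shift]; simp

end

section

open fwdDiff

lemma abs_fwdDiff_two_sub_le {E : Type*} [AddCommGroup E] (h : E) (k : ℕ) (f : E → ℝ) (x : E) :
    |Δ_[h + h] ^[k] f x - 2 ^ k * Δ_[h] ^[k] f x| ≤
      k * 2 ^ k * ∑ i ∈ Finset.range (k + 1), |Δ_[h] ^[k + 1] f (x + i • h)| := by
  induction k generalizing f with
  | zero => simp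
  | succ k ih =>
    have h1 : Δ_[h + h] f = fun y => (2 : ℝ) * Δ_[h] f y + Δ_[h] ^[2] f y := by
      ext y
      simp only [fwdDiff, Function.iterate_succ, Function.iterate_zero, Function.comp_apply, id,
        add_assoc]
      ring
    have h2 : ∀ m y, Δ_[h] ^[m] (Δ_[h + h] f) y =
        Δ_[h] ^[m + 1] f (y + h) + Δ_[h] ^[m + 1] f y := by
      intro m y
      have : Δ_[h + h] f = (fun y => Δ_[h] f (y + h)) + Δ_[h] f := by
        ext y; simp [fwdDiff, add_assoc]
      rw [this, fwdDiff_iter_add, Pi.add_apply, fwdDiff_iter_comp_add]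
      rfl
    have h3 : Δ_[h] ^[k] (Δ_[h + h] f) x - 2 * Δ_[h] ^[k + 1] f x = Δ_[h] ^[k + 2] f x := by
      rw [h2, Function.iterate_succ_apply' _ (k + 1)]
      simp only [fwdDiff]
      ring
    have h4 := ih (Δ_[h + h] f)
    set S := ∑ i ∈ Finset.range (k + 1 + 1), |Δ_[h] ^[k + 1 + 1] f (x + i • h)| with hS
    have h5 : ∑ i ∈ Finset.range (k + 1), |Δ_[h] ^[k + 1] (Δ_[h + h] f) (x + i • h)| ≤ 2 * S := by
      have e1 : ∑ i ∈ Finset.range (k + 1), |Δ_[h] ^[k + 2] f (x + (i + 1) • h)| ≤ S := by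
        rw [hS, Finset.sum_range_succ' _ (k + 1)]
        exact le_add_of_nonneg_right (abs_nonneg _)
      have e2 : ∑ i ∈ Finset.range (k + 1), |Δ_[h] ^[k + 2] f (x + i • h)| ≤ S := by
        rw [hS, Finset.sum_range_succ _ (k + 1)]
        exact le_add_of_nonneg_right (abs_nonneg _)
      calc _ ≤ ∑ i ∈ Finset.range (k + 1), (|Δ_[h] ^[k + 2] f (x + (i + 1) • h)| +
            |Δ_[h] ^[k + 2] f (x + i • h)|) := Finset.sum_le_sum fun i _ => by
              rw [h2, add_smul, one_smul, ← add_assoc]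
              exact abs_add_le _ _
        _ ≤ _ := by rw [Finset.sum_add_distrib]; linarith
    have h6 : |Δ_[h] ^[k + 2] f x| ≤ S := by
      have := Finset.single_le_sum (f := fun i : ℕ => |Δ_[h] ^[k + 1 + 1] f (x + i • h)|)
        (fun i _ => abs_nonneg _) (show 0 ∈ Finset.range (k + 1 + 1) by simp)
      simpa only [zero_smul, add_zero] using this
    rw [Function.iterate_succ_apply]
    have h7 : Δ_[h + h] ^[k] (Δ_[h + h] f) x - 2 ^ (k + 1) * Δ_[h] ^[k + 1] f x =
        (Δ_[h + h] ^[k] (Δ_[h + h] f) x - 2 ^ k * Δ_[h] ^[k] (Δ_[h + h] f) x) +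
          2 ^ k * Δ_[h] ^[k + 2] f x := by
      rw [← h3]; ring
    rw [h7]
    refine (abs_add_le _ _).trans ?_
    rw [abs_mul, abs_of_nonneg (by positivity : (0 : ℝ) ≤ 2 ^ k)]
    have hS0 : 0 ≤ S := by positivity
    calc _ ≤ k * 2 ^ k * (2 * S) + 2 ^ k * S := by
          gcongr
          exact h4.trans (by gcongr)
      _ ≤ _ := by
        push_cast
        rw [pow_succ]
        nlinarith [mul_nonneg (by positivity : (0 : ℝ) ≤ 2 ^ k) hS0]

/-- The integral of `Y h x` over `h > η` and `x`, with respect to the measure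
`h ^ (-1 - 2 * s) dh dx`. -/
def energy (s η : ℝ) (Y : ℝ → E3 → ℝ) : ℝ≥0∞ :=
  ∫⁻ h in Ioi η, ENNReal.ofReal (h ^ (-1 - 2 * s)) * ∫⁻ x, ENNReal.ofReal (Y h x)

lemma energy_mono {s η : ℝ} {Y Z : ℝ → E3 → ℝ} (hYZ : ∀ t x, Y t x ≤ Z t x) :
    energy s η Y ≤ energy s η Z := by
  unfold energy
  gcongr
  exact hYZ _ _

lemma energy_anti {s η θ : ℝ} (h : η ≤ θ) (Y : ℝ → E3 → ℝ) :
    energy s θ Y ≤ energy s η Y :=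
  lintegral_mono_set (Ioi_subset_Ioi h)

lemma energy_add {s η : ℝ} {Y Z : ℝ → E3 → ℝ} (hY : Measurable (Function.uncurry Y))
    (hY0 : ∀ t x, 0 ≤ Y t x) (hZ0 : ∀ t x, 0 ≤ Z t x) :
    energy s η (fun t x => Y t x + Z t x) = energy s η Y + energy s η Z := by
  unfold energy
  have h1 : Measurable fun p : ℝ × E3 => ENNReal.ofReal (Y p.1 p.2) := hY.ennreal_ofReal
  rw [← lintegral_add_left]
  · refine lintegral_congr fun t => ?_
    have h2 : Measurable fun x => ENNReal.ofReal (Y t x) := h1.comp measurable_prodMk_left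
    rw [← mul_add, ← lintegral_add_left h2]
    simp_rw [ENNReal.ofReal_add (hY0 _ _) (hZ0 _ _)]
  · exact (by fun_prop : Measurable fun h : ℝ => ENNReal.ofReal (h ^ (-1 - 2 * s))).mul
      h1.lintegral_prod_right'

lemma energy_const_mul {s η : ℝ} {Y : ℝ → E3 → ℝ} {c : ℝ} (hc : 0 ≤ c) :
    energy s η (fun t x => c * Y t x) = ENNReal.ofReal c * energy s η Y := by
  unfold energy
  rw [← lintegral_const_mul' _ _ ENNReal.ofReal_ne_top]
  refine lintegral_congr fun t => ?_
  simp_rw [ENNReal.ofReal_mul hc]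
  rw [lintegral_const_mul' _ _ ENNReal.ofReal_ne_top]
  ring

lemma energy_sum {s η : ℝ} {ι : Type*} (F : Finset ι) {Y : ι → ℝ → E3 → ℝ}
    (hY : ∀ i, Measurable (Function.uncurry (Y i))) (hY0 : ∀ i t x, 0 ≤ Y i t x) :
    energy s η (fun t x => ∑ i ∈ F, Y i t x) = ∑ i ∈ F, energy s η (Y i) := by
  classical
  induction F using Finset.induction_on with
  | empty => simp [energy]
  | insert a F ha ih =>
    simp_rw [Finset.sum_insert ha]
    rw [energy_add (hY a) (hY0 a) (fun t x => Finset.sum_nonneg fun i _ => hY0 i t x), ih]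

lemma energy_shift {s η : ℝ} (Y : ℝ → E3 → ℝ) (v : ℝ → E3) :
    energy s η (fun t x => Y t (x + v t)) = energy s η Y := by
  unfold energy
  refine lintegral_congr fun t => ?_
  rw [lintegral_add_right_eq_self fun x => ENNReal.ofReal (Y t x)]

lemma energy_dilate {s η K : ℝ} (hK : 0 < K) (hη : 0 ≤ η) (Y : ℝ → E3 → ℝ) :
    energy s η (fun t x => Y (K * t) x) = ENNReal.ofReal (K ^ (2 * s)) * energy s (K * η) Y := by
  unfold energy
  have himg : (fun t => K * t) '' Ioi η = Ioi (K * η) := Set.image_mul_left_Ioi hK η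
  rw [← himg, lintegral_image_eq_lintegral_abs_deriv_mul (f' := fun _ => K) measurableSet_Ioi
    (fun x _ => by simpa using ((hasDerivAt_id x).const_mul K).hasDerivWithinAt)
    (mul_right_injective₀ hK.ne').injOn, ← lintegral_const_mul' _ _ ENNReal.ofReal_ne_top]
  refine setLIntegral_congr_fun measurableSet_Ioi fun t ht => ?_
  have ht0 : 0 < t := lt_of_le_of_lt hη ht
  simp only
  rw [← mul_assoc, ← mul_assoc, ← ENNReal.ofReal_mul (by positivity),
    ← ENNReal.ofReal_mul (by positivity), abs_of_pos hK, Real.mul_rpow hK.le ht0.le]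
  congr 2
  rw [Real.rpow_sub hK, Real.rpow_neg_one]
  field_simp

lemma energy_dilate_le {s η K : ℝ} (hK : 1 ≤ K) (hη : 0 ≤ η) (Y : ℝ → E3 → ℝ) :
    energy s η (fun t x => Y (K * t) x) ≤ ENNReal.ofReal (K ^ (2 * s)) * energy s η Y := by
  rw [energy_dilate (by linarith) hη]
  gcongr
  exact energy_anti (by nlinarith) _

lemma energy_zero_le {s : ℝ} {Y : ℝ → E3 → ℝ} {B : ℝ≥0∞}
    (h : ∀ η, 0 < η → energy s η Y ≤ B) : energy s 0 Y ≤ B := by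
  have hU : Ioi (0 : ℝ) = ⋃ n : ℕ, Ioi (1 / ((n : ℝ) + 1)) := by
    ext t
    simp only [mem_Ioi, mem_iUnion]
    exact ⟨fun ht => exists_nat_one_div_lt ht, fun ⟨n, hn⟩ => lt_trans (by positivity) hn⟩
  have hd : Directed (· ⊆ ·) fun n : ℕ => Ioi (1 / ((n : ℝ) + 1)) :=
    Monotone.directed_le (f := fun n : ℕ => Ioi (1 / ((n : ℝ) + 1))) fun m n hmn =>
      Ioi_subset_Ioi (Nat.one_div_le_one_div hmn)
  unfold energy
  rw [hU, setLIntegral_iUnion_of_directed _ hd]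
  exact iSup_le fun n => h _ (by positivity)

lemma energy_lt_top_of_inner_le {s η : ℝ} (hs : 0 < s) (hη : 0 < η) {Y : ℝ → E3 → ℝ} {B : ℝ≥0∞}
    (hB : B ≠ ⊤) (hY : ∀ t, ∫⁻ x, ENNReal.ofReal (Y t x) ≤ B) : energy s η Y < ⊤ := by
  unfold energy
  calc _ ≤ ∫⁻ t in Ioi η, ENNReal.ofReal (t ^ (-1 - 2 * s)) * B := by gcongr; exact hY _
    _ = (∫⁻ t in Ioi η, ENNReal.ofReal (t ^ (-1 - 2 * s))) * B := lintegral_mul_const' _ _ hB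
    _ < ⊤ := by
      refine ENNReal.mul_lt_top ?_ hB.lt_top
      have := (integrableOn_Ioi_rpow_of_lt (by linarith : -1 - 2 * s < -1) hη)
      exact this.lintegral_lt_top

lemma le_mul_of_le_mul_add {X B : ℝ≥0∞} {θ : ℝ} (hθ0 : 0 ≤ θ) (hθ : θ < 1) (hX : X ≠ ⊤)
    (h : X ≤ ENNReal.ofReal θ * X + B) : X ≤ ENNReal.ofReal (1 - θ)⁻¹ * B := by
  have h1 : ENNReal.ofReal (1 - θ) * X ≤ B := by
    rw [ENNReal.ofReal_sub _ hθ0, ENNReal.ofReal_one, ENNReal.sub_mul (fun _ _ => hX), one_mul]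
    exact tsub_le_iff_left.2 h
  calc X = ENNReal.ofReal (1 - θ)⁻¹ * (ENNReal.ofReal (1 - θ) * X) := by
        rw [← mul_assoc, ← ENNReal.ofReal_mul (by simp; linarith), inv_mul_cancel₀ (by linarith)]
        simp
    _ ≤ _ := by gcongr

/-- The `k`-th difference of `f` at `x` in direction `e` with step `h`. -/
def stepDiff (e : E3) (k : ℕ) (f : E3 → ℝ) (h : ℝ) (x : E3) : ℝ := Δ_[h • e] ^[k] f x

/-- `f` is measurable, bounded by `M` and square integrable. -/
structure IsBddL2 (M : ℝ) (f : E3 → ℝ) : Prop where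
  measurable : Measurable f
  abs_le : ∀ x, |f x| ≤ M
  sq_ne_top : ∫⁻ x, ENNReal.ofReal (f x ^ 2) ≠ ⊤

lemma measurable_stepDiff {f : E3 → ℝ} (hf : Measurable f) (e : E3) (k : ℕ) :
    Measurable (Function.uncurry (stepDiff e k f)) := by
  unfold stepDiff Function.uncurry
  simp only [fwdDiff_iter_eq_sum_shift]
  fun_prop

lemma abs_stepDiff_le {f : E3 → ℝ} {M : ℝ} (hf : ∀ x, |f x| ≤ M) (e : E3) (k : ℕ) (h : ℝ) (x : E3) :
    |stepDiff e k f h x| ≤ 2 ^ k * ((k + 1) * M) := by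
  refine (abs_fwdDiff_iter_le _ _ _ _).trans ?_
  gcongr
  refine (Finset.sum_le_sum fun i _ => hf _).trans ?_
  simp

lemma stepDiff_one (e : E3) (f : E3 → ℝ) (h : ℝ) (x : E3) :
    stepDiff e 1 f h x = f (x + h • e) - f x := rfl

lemma stepDiff_two (e : E3) (f : E3 → ℝ) (h : ℝ) (x : E3) :
    stepDiff e 2 f h x = f (x + (2 * h) • e) - 2 * f (x + h • e) + f x := by
  simp only [stepDiff, fwdDiff, Function.iterate_succ, Function.iterate_zero, Function.comp_apply,
    id, add_assoc, ← add_smul, ← two_mul]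
  ring

lemma stepDiff_add_sq_le (e : E3) (k j : ℕ) (f : E3 → ℝ) (h : ℝ) (x : E3) :
    stepDiff e (k + j) f h x ^ 2 ≤ (2 ^ j) ^ 2 * (j + 1) *
      ∑ i ∈ Finset.range (j + 1), stepDiff e k f h (x + (i * h) • e) ^ 2 := by
  have h1 := abs_fwdDiff_iter_le (h • e) j (Δ_[h • e] ^[k] f) x
  rw [← Function.iterate_add_apply, add_comm j k] at h1
  rw [stepDiff, ← sq_abs]
  refine (pow_le_pow_left₀ (abs_nonneg _) h1 2).trans ?_
  rw [mul_pow, mul_assoc]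
  gcongr
  refine (sq_sum_le_card_mul_sum_sq).trans ?_
  simp [stepDiff, smul_smul, ← Nat.cast_smul_eq_nsmul ℝ]

lemma energy_sum_shift {s η : ℝ} {Y : ℝ → E3 → ℝ} (hY : Measurable (Function.uncurry Y))
    (hY0 : ∀ t x, 0 ≤ Y t x) (e : E3) (n : ℕ) (a : ℕ → ℝ) :
    energy s η (fun t x => ∑ i ∈ Finset.range n, Y t (x + (a i * t) • e)) =
      n * energy s η Y := by
  rw [energy_sum (Y := fun i t x => Y t (x + (a i * t) • e))]
  · rw [Finset.sum_congr rfl fun i _ => energy_shift Y fun t => (a i * t) • e]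
    simp
  · intro i
    exact hY.comp (by fun_prop : Measurable fun p : ℝ × E3 => (p.1, p.2 + (a i * p.1) • e))
  · exact fun i t x => hY0 _ _

lemma energy_stepDiff_add_le {s η : ℝ} {f : E3 → ℝ} (hf : Measurable f) (e : E3) (k j : ℕ) :
    energy s η (fun h x => stepDiff e (k + j) f h x ^ 2) ≤
      ENNReal.ofReal ((2 ^ j) ^ 2 * (j + 1)) * ((j + 1 : ℕ) *
        energy s η (fun h x => stepDiff e k f h x ^ 2)) := by
  refine (energy_mono fun h x => stepDiff_add_sq_le e k j f h x).trans ?_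
  rw [energy_const_mul (by positivity)]
  gcongr
  exact (energy_sum_shift (Y := fun h x => stepDiff e k f h x ^ 2)
    ((measurable_stepDiff hf e k).pow_const 2) (fun _ _ => sq_nonneg _) e (j + 1) _).le

lemma energy_stepDiff_sq_lt_top {s η M : ℝ} (hs : 0 < s) (hη : 0 < η) {f : E3 → ℝ}
    (hf : IsBddL2 M f) (e : E3) (k : ℕ) :
    energy s η (fun h x => stepDiff e k f h x ^ 2) < ⊤ := by
  have := energy_stepDiff_add_le (s := s) (η := η) hf.measurable e 0 k
  rw [zero_add] at this
  refine this.trans_lt (ENNReal.mul_lt_top ENNReal.ofReal_lt_top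
    (ENNReal.mul_lt_top (ENNReal.natCast_lt_top _) ?_))
  exact energy_lt_top_of_inner_le hs hη hf.sq_ne_top fun t => le_rfl

lemma abs_rpow_le_mul_sq {R p t : ℝ} (hp : 2 ≤ p) (ht : |t| ≤ R) : |t| ^ p ≤ R ^ (p - 2) * t ^ 2 := by
  rcases eq_or_ne t 0 with rfl | h0
  · simp [Real.zero_rpow (by linarith : p ≠ 0)]
  · calc |t| ^ p = |t| ^ (p - 2) * |t| ^ (2 : ℝ) := by
          rw [← Real.rpow_add (abs_pos.2 h0)]; congr 1; ring
      _ ≤ R ^ (p - 2) * t ^ 2 := by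
          rw [Real.rpow_two, sq_abs]
          gcongr

/-- Energies of powers of differences are controlled by those of squares. -/
lemma energy_stepDiff_rpow_le {s η M p : ℝ} (hp : 2 ≤ p) (hM : 0 ≤ M) {f : E3 → ℝ}
    (hf : IsBddL2 M f) (e : E3) (k : ℕ) :
    energy s η (fun h x => |stepDiff e k f h x| ^ p) ≤
      ENNReal.ofReal ((2 ^ k * ((k + 1) * M)) ^ (p - 2)) *
        energy s η (fun h x => stepDiff e k f h x ^ 2) := by
  rw [← energy_const_mul (by positivity)]
  exact energy_mono fun h x => abs_rpow_le_mul_sq hp (abs_stepDiff_le hf.abs_le e k h x)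

lemma energy_stepDiff_rpow_lt_top {s η M p : ℝ} (hs : 0 < s) (hη : 0 < η) (hp : 2 ≤ p)
    (hM : 0 ≤ M) {f : E3 → ℝ} (hf : IsBddL2 M f) (e : E3) (k : ℕ) :
    energy s η (fun h x => |stepDiff e k f h x| ^ p) < ⊤ :=
  (energy_stepDiff_rpow_le hp hM hf e k).trans_lt
    (ENNReal.mul_lt_top ENNReal.ofReal_lt_top (energy_stepDiff_sq_lt_top hs hη hf e k))

lemma exists_one_add_mul_lt_one {q : ℝ} (hq0 : 0 < q) (hq : q < 1) :
    ∃ ε : ℝ, 0 < ε ∧ (1 + ε) * q < 1 := by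
  refine ⟨(1 / q - 1) / 2, ?_, ?_⟩
  · have : 1 < 1 / q := by rw [lt_div_iff₀ hq0]; linarith
    linarith
  · have : (1 + (1 / q - 1) / 2) * q = (1 + q) / 2 := by field_simp; ring
    linarith

lemma exists_energy_stepDiff_succ {s M p : ℝ} (hs : 0 < s) (hp : 2 ≤ p) (hM : 0 ≤ M) {k : ℕ}
    (hk : 2 * s < k * p) : ∃ C : ℝ≥0∞, C ≠ ⊤ ∧ ∀ (e : E3) (f : E3 → ℝ) (η : ℝ), 0 < η →
      IsBddL2 M f → energy s η (fun h x => |stepDiff e k f h x| ^ p) ≤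
        C * energy s η (fun h x => |stepDiff e (k + 1) f h x| ^ p) := by
  have hp0 : 0 < p := by linarith
  obtain ⟨ε, hε, hθ⟩ := exists_one_add_mul_lt_one (q := 2 ^ (2 * s - k * p)) (by positivity)
    (Real.rpow_lt_one_of_one_lt_of_neg (by norm_num) (by linarith))
  obtain ⟨C, hC, hCb⟩ := exists_add_rpow_le hp0 hε
  set θ := (1 + ε) * 2 ^ (2 * s - k * p) with hθdef
  set c₁ : ℝ := 2 ^ (-(k * p)) * (1 + ε) with hc₁
  set c₂ : ℝ := 2 ^ (-(k * p)) * (C * ((k * 2 ^ k) ^ p * ((k + 1 : ℕ) : ℝ) ^ (p - 1))) with hc₂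
  have hpt : ∀ (e : E3) (f : E3 → ℝ) (h : ℝ) (x : E3), |stepDiff e k f h x| ^ p ≤
      c₁ * |stepDiff e k f (2 * h) x| ^ p + c₂ * ∑ i ∈ Finset.range (k + 1),
        |stepDiff e (k + 1) f h (x + (i * h) • e)| ^ p := by
    intro e f h x
    set S := ∑ i ∈ Finset.range (k + 1), |stepDiff e (k + 1) f h (x + (i * h) • e)| with hS
    have h1 : 2 ^ k * |stepDiff e k f h x| ≤ |stepDiff e k f (2 * h) x| + k * 2 ^ k * S := by
      have h2 := abs_fwdDiff_two_sub_le (h • e) k f x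
      rw [← add_smul, ← two_mul] at h2
      have h3 : ∑ i ∈ Finset.range (k + 1), |Δ_[h • e] ^[k + 1] f (x + i • h • e)| = S := by
        refine Finset.sum_congr rfl fun i _ => ?_
        rw [stepDiff, ← smul_smul, Nat.cast_smul_eq_nsmul]
      rw [h3] at h2
      have h4 := abs_sub_abs_le_abs_sub (2 ^ k * Δ_[h • e] ^[k] f x) (Δ_[(2 * h) • e] ^[k] f x)
      rw [abs_mul, abs_of_nonneg (by positivity : (0 : ℝ) ≤ 2 ^ k), abs_sub_comm (2 ^ k * _)] at h4
      simp only [stepDiff]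
      linarith
    have h5 : |stepDiff e k f h x| = 2 ^ (-(k : ℝ)) * (2 ^ k * |stepDiff e k f h x|) := by
      rw [← mul_assoc, Real.rpow_neg (by norm_num), Real.rpow_natCast, inv_mul_cancel₀ (by positivity),
        one_mul]
    have hS0 : 0 ≤ S := by positivity
    have hSp : S ^ p ≤ ((k + 1 : ℕ) : ℝ) ^ (p - 1) * ∑ i ∈ Finset.range (k + 1),
        |stepDiff e (k + 1) f h (x + (i * h) • e)| ^ p := by
      have := Real.rpow_sum_le_const_mul_sum_rpow (Finset.range (k + 1))
        (fun i => stepDiff e (k + 1) f h (x + (i * h) • e)) (by linarith : 1 ≤ p)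
      simpa using this
    calc |stepDiff e k f h x| ^ p
        = 2 ^ (-(k * p)) * (2 ^ k * |stepDiff e k f h x|) ^ p := by
          conv_lhs => rw [h5, Real.mul_rpow (by positivity) (by positivity),
            ← Real.rpow_mul (by norm_num)]
          congr 2; ring
      _ ≤ 2 ^ (-(k * p)) * (|stepDiff e k f (2 * h) x| + k * 2 ^ k * S) ^ p := by gcongr
      _ ≤ 2 ^ (-(k * p)) * ((1 + ε) * |stepDiff e k f (2 * h) x| ^ p +
            C * (k * 2 ^ k * S) ^ p) := by
          gcongr
          exact hCb _ _ (by positivity) (by positivity)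
      _ ≤ 2 ^ (-(k * p)) * ((1 + ε) * |stepDiff e k f (2 * h) x| ^ p +
            C * ((k * 2 ^ k) ^ p * (((k + 1 : ℕ) : ℝ) ^ (p - 1) * ∑ i ∈ Finset.range (k + 1),
        |stepDiff e (k + 1) f h (x + (i * h) • e)| ^ p))) := by
          rw [Real.mul_rpow (by positivity) hS0]
          gcongr
      _ = _ := by rw [hc₁, hc₂]; ring
  refine ⟨ENNReal.ofReal (1 - θ)⁻¹ * (ENNReal.ofReal c₂ * (k + 1 : ℕ)), ?_, ?_⟩
  · exact ENNReal.mul_ne_top ENNReal.ofReal_ne_top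
      (ENNReal.mul_ne_top ENNReal.ofReal_ne_top (ENNReal.natCast_ne_top _))
  intro e f η hη hf
  rw [mul_assoc]
  refine le_mul_of_le_mul_add (by positivity) hθ
    (energy_stepDiff_rpow_lt_top hs hη hp hM hf e k).ne ?_
  have hmk : ∀ k, Measurable (Function.uncurry fun h x => |stepDiff e k f h x| ^ p) := fun k =>
    (measurable_stepDiff hf.measurable e k).abs.pow_const p
  refine (energy_mono fun h x => hpt e f h x).trans ?_
  rw [energy_add, energy_const_mul (by positivity), energy_const_mul (by positivity),
    energy_sum_shift (Y := fun h x => |stepDiff e (k + 1) f h x| ^ p) (hmk (k + 1))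
      (fun _ _ => by positivity) e (k + 1), mul_assoc (ENNReal.ofReal c₂)]
  · gcongr ?_ + _
    calc _ ≤ ENNReal.ofReal c₁ * (ENNReal.ofReal (2 ^ (2 * s)) *
          energy s η fun h x => |stepDiff e k f h x| ^ p) := by
          gcongr
          exact energy_dilate_le one_le_two hη.le fun h x => |stepDiff e k f h x| ^ p
      _ = _ := by
          rw [← mul_assoc, ← ENNReal.ofReal_mul (by positivity)]
          congr 2
          rw [hc₁, hθdef, mul_right_comm, ← Real.rpow_add (by norm_num), mul_comm]
          congr 2; ring
  · exact ((hmk k).comp (by fun_prop : Measurable fun q : ℝ × E3 => (2 * q.1, q.2))).const_mul c₁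
  · exact fun _ _ => by positivity
  · exact fun _ _ => by positivity

/-- Energies of `p`-th powers of lower order differences are controlled by the energy of the square
of a difference of higher order. -/
lemma exists_energy_stepDiff_rpow_le {s M p : ℝ} (hs : 0 < s) (hp : 2 ≤ p) (hM : 0 ≤ M) {k K : ℕ}
    (hk : 2 * s < k * p) (hkK : k ≤ K) : ∃ C : ℝ≥0∞, C ≠ ⊤ ∧
      ∀ (e : E3) (f : E3 → ℝ) (η : ℝ), 0 < η → IsBddL2 M f →
        energy s η (fun h x => |stepDiff e k f h x| ^ p) ≤
          C * energy s η (fun h x => stepDiff e K f h x ^ 2) := by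
  induction hkK using Nat.decreasingInduction with
  | self => exact ⟨_, ENNReal.ofReal_ne_top, fun e f η _ hf => energy_stepDiff_rpow_le hp hM hf e K⟩
  | of_succ k hkK ih =>
    obtain ⟨C₁, hC₁, h₁⟩ := exists_energy_stepDiff_succ hs hp hM hk
    obtain ⟨C₂, hC₂, h₂⟩ := ih (by push_cast; nlinarith)
    refine ⟨C₁ * C₂, ENNReal.mul_ne_top hC₁ hC₂, fun e f η hη hf => ?_⟩
    refine (h₁ e f η hη hf).trans ?_
    rw [mul_assoc]
    gcongr
    exact h₂ e f η hη hf

lemma measurable_crossing (p : ℝ) : Measurable fun q : ℝ × ℝ => crossing p q.1 q.2 := by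
  unfold crossing
  refine Measurable.ite ?_ (by fun_prop) measurable_const
  exact measurableSet_lt (by fun_prop) measurable_const

lemma measurable_damped (β : ℝ) (L : ℕ) : Measurable fun q : ℝ × ℝ => damped β L q.1 q.2 := by
  unfold damped
  fun_prop

lemma exists_energy_crossing_le {s M β : ℝ} (hs : 0 < s) (hβ : 1 < β) (hsβ : s < β + 1 / 2)
    (hM : 0 ≤ M) : ∃ C : ℝ≥0∞, C ≠ ⊤ ∧ ∀ (e : E3) (f : E3 → ℝ) (η : ℝ), 0 < η → IsBddL2 M f →
      energy s η (fun h x => crossing (2 * β) (f x) (f (x + h • e))) ≤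
        C * energy s η (fun h x => |stepDiff e 2 f h x| ^ (2 * β)) := by
  obtain ⟨ε, hε, hθ⟩ := exists_one_add_mul_lt_one (q := 2 ^ (2 * s - 2 * β - 1)) (by positivity)
    (Real.rpow_lt_one_of_one_lt_of_neg (by norm_num) (by linarith))
  obtain ⟨C, hC, hCb⟩ := exists_crossing_add_crossing_le (p := 2 * β) (by linarith) hε
  set θ := (1 + ε) * 2 ^ (2 * s - 2 * β - 1) with hθdef
  set c₁ : ℝ := (1 + ε) * 2 ^ (-(2 * β)) / 2 with hc₁
  refine ⟨ENNReal.ofReal (1 - θ)⁻¹ * ENNReal.ofReal (C / 2),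
    ENNReal.mul_ne_top ENNReal.ofReal_ne_top ENNReal.ofReal_ne_top, ?_⟩
  intro e f η hη hf
  set X : ℝ → E3 → ℝ := fun h x => crossing (2 * β) (f x) (f (x + h • e)) with hX
  have hXm : Measurable (Function.uncurry X) := by
    have := hf.measurable
    exact (measurable_crossing (2 * β)).comp
      (by fun_prop : Measurable fun q : ℝ × E3 => (f q.2, f (q.2 + q.1 • e)))
  have hX0 : ∀ t x, 0 ≤ X t x := fun _ _ => crossing_nonneg _ _ _
  have hfin : energy s η X ≠ ⊤ := by
    refine ne_top_of_le_ne_top (energy_stepDiff_rpow_lt_top hs hη (by linarith : 2 ≤ 2 * β)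
      hM hf e 1).ne (energy_mono fun h x => ?_)
    rw [stepDiff_one]
    exact crossing_le _ _ _
  rw [mul_assoc]
  refine le_mul_of_le_mul_add (by positivity) hθ hfin ?_
  have hdm : Measurable (Function.uncurry fun h x => |stepDiff e 2 f h x| ^ (2 * β)) :=
    (measurable_stepDiff hf.measurable e 2).abs.pow_const _
  have hhalf : energy s η X = energy s η (fun h x => 1 / 2 * X h x + 1 / 2 * X h (x + h • e)) := by
    rw [energy_add (hXm.const_mul _) (fun t x => by have := hX0 t x; positivity)
      (fun t x => by have := hX0 t (x + t • e); positivity), energy_const_mul (by norm_num),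
      energy_const_mul (Y := fun h x => X h (x + h • e)) (by norm_num),
      energy_shift X fun h => h • e, ← add_mul, ← ENNReal.ofReal_add (by norm_num) (by norm_num)]
    norm_num
  rw [hhalf]
  have hpt : ∀ h x, 1 / 2 * X h x + 1 / 2 * X h (x + h • e) ≤
      c₁ * X (2 * h) x + C / 2 * |stepDiff e 2 f h x| ^ (2 * β) := by
    intro h x
    have := hCb (f x) (f (x + h • e)) (f (x + (2 * h) • e))
    rw [← stepDiff_two] at this
    have h2 : X h (x + h • e) = crossing (2 * β) (f (x + h • e)) (f (x + (2 * h) • e)) := by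
      simp only [hX]; rw [add_assoc, ← add_smul, ← two_mul]
    rw [h2, hc₁]
    simp only [hX]
    linarith
  refine (energy_mono hpt).trans ?_
  have m : Measurable (Function.uncurry fun h x => c₁ * X (2 * h) x) :=
    (hXm.comp (by fun_prop : Measurable fun q : ℝ × E3 => (2 * q.1, q.2))).const_mul c₁
  rw [energy_add m
    (fun t x => mul_nonneg (by positivity) (hX0 _ _)) (fun t x => by positivity),
    energy_const_mul (by positivity), energy_const_mul (by positivity), ← hhalf]
  gcongr ?_ + _
  calc _ ≤ ENNReal.ofReal c₁ * (ENNReal.ofReal (2 ^ (2 * s)) * energy s η X) := by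
        gcongr
        exact energy_dilate_le one_le_two hη.le X
    _ = _ := by
        rw [← mul_assoc, ← ENNReal.ofReal_mul (by positivity)]
        congr 2
        rw [hc₁, hθdef, Real.rpow_sub_one (by norm_num), sub_eq_add_neg (2 * s),
          Real.rpow_add (by norm_num)]
        ring

lemma exists_energy_damped_le {s M β : ℝ} {L : ℕ} (hs : 0 < s) (hβ : 1 < β) (hL : β < L)
    (hLs : ((37 / 25 : ℝ)⁻¹ ^ L) ^ 2 * 2 ^ (2 * s) < 1)
    (hM : 0 ≤ M) : ∃ C : ℝ≥0∞, C ≠ ⊤ ∧ ∀ (e : E3) (f : E3 → ℝ) (η : ℝ), 0 < η → IsBddL2 M f →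
      energy s η (fun h x => damped β L (f x) (stepDiff e 1 f h x) ^ 2) ≤
        C * (energy s η (fun h x => crossing (2 * β) (f x) (f (x + h • e))) +
          energy s η (fun h x => |stepDiff e 2 f h x| ^ (2 * β))) := by
  set θ := ((37 / 25 : ℝ)⁻¹ ^ L) ^ 2 * 2 ^ (2 * s) with hθdef
  set c : ℝ≥0∞ := ENNReal.ofReal (16 ^ (2 * s)) + ENNReal.ofReal (64 ^ (2 * β)) * (15 : ℕ) with hc
  have hctop : c ≠ ⊤ := ENNReal.add_ne_top.2 ⟨ENNReal.ofReal_ne_top,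
    ENNReal.mul_ne_top ENNReal.ofReal_ne_top (ENNReal.natCast_ne_top _)⟩
  refine ⟨ENNReal.ofReal (1 - θ)⁻¹ * c, ENNReal.mul_ne_top ENNReal.ofReal_ne_top hctop, ?_⟩
  intro e f η hη hf
  have hfm := hf.measurable
  set X : ℝ → E3 → ℝ := fun h x => crossing (2 * β) (f x) (f (x + h • e)) with hX
  set D : ℝ → E3 → ℝ := fun h x => |stepDiff e 2 f h x| ^ (2 * β) with hD
  set W : ℝ → E3 → ℝ := fun h x => damped β L (f x) (stepDiff e 1 f h x) ^ 2 with hW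
  have hXm : Measurable (Function.uncurry X) :=
    (measurable_crossing (2 * β)).comp
      (by fun_prop : Measurable fun q : ℝ × E3 => (f q.2, f (q.2 + q.1 • e)))
  have hX0 : ∀ t x, 0 ≤ X t x := fun _ _ => crossing_nonneg _ _ _
  have hDm : Measurable (Function.uncurry D) := (measurable_stepDiff hfm e 2).abs.pow_const _
  have hD0 : ∀ t x, 0 ≤ D t x := fun _ _ => by positivity
  have hWm : Measurable (Function.uncurry W) :=
    ((measurable_damped β L).comp ((hfm.comp measurable_snd).prodMk
      (measurable_stepDiff hfm e 1))).pow_const 2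
  have hW0 : ∀ t x, 0 ≤ W t x := fun _ _ => by positivity
  have hfin : energy s η W ≠ ⊤ := by
    refine ne_top_of_le_ne_top (energy_stepDiff_rpow_lt_top hs hη (by linarith : 2 ≤ 2 * β)
      hM hf e 1).ne (energy_mono fun h x => ?_)
    calc W h x ≤ (|stepDiff e 1 f h x| ^ β) ^ 2 :=
          pow_le_pow_left₀ (damped_nonneg _ _ _ _) (damped_le (by linarith) hL _ _) 2
      _ = _ := by rw [← Real.rpow_natCast, ← Real.rpow_mul (abs_nonneg _)]; congr 1; ring
  rw [mul_assoc]
  refine le_mul_of_le_mul_add (by positivity) hLs hfin ?_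
  have hpt : ∀ h x, W h x ≤ ((37 / 25 : ℝ)⁻¹ ^ L) ^ 2 * W (2 * h) x +
      (X (16 * h) (x + (-8 * h) • e) + 64 ^ (2 * β) *
        ∑ i ∈ Finset.range 15, D h (x + (((i : ℝ) - 8) * h) • e)) := by
    intro h x
    set A : ℕ → ℝ := fun i => f (x + (((i : ℝ) - 8) * h) • e) with hA
    have e8 : A 8 = f x := by simp [hA]
    have e9 : A 9 = f (x + h • e) := by simp only [hA]; norm_num
    have e10 : A 10 = f (x + (2 * h) • e) := by simp only [hA]; norm_num
    have e0 : A 0 = f (x + (-8 * h) • e) := by simp only [hA]; norm_num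
    have e16 : A 16 = f (x + (-8 * h) • e + (16 * h) • e) := by
      simp only [hA]; rw [add_assoc, ← add_smul, ← add_mul]; norm_num
    have eD : ∀ i : ℕ, |A (i + 2) - 2 * A (i + 1) + A i| ^ (2 * β) =
        D h (x + (((i : ℝ) - 8) * h) • e) := by
      intro i
      simp only [hD, stepDiff_two, hA]
      rw [add_assoc x, add_assoc x, ← add_smul, ← add_smul]
      push_cast
      ring_nf
    have := damped_sq_le (by linarith : 0 < β) hL A
    simp only [eD] at this
    rw [e8, e9, e10, e0, e16, add_assoc] at this
    exact this
  refine (energy_mono hpt).trans ?_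
  have m1 : Measurable (Function.uncurry fun h x => ((37 / 25 : ℝ)⁻¹ ^ L) ^ 2 * W (2 * h) x) :=
    (hWm.comp (by fun_prop : Measurable fun q : ℝ × E3 => (2 * q.1, q.2))).const_mul _
  have m2 : Measurable (Function.uncurry fun h x => X (16 * h) (x + (-8 * h) • e)) :=
    hXm.comp (by fun_prop : Measurable fun q : ℝ × E3 => (16 * q.1, q.2 + (-8 * q.1) • e))
  have n3 : ∀ h x, 0 ≤ 64 ^ (2 * β) *
        ∑ i ∈ Finset.range 15, D h (x + (((i : ℝ) - 8) * h) • e) := fun h x => by positivity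
  rw [energy_add m1 (fun _ _ => by positivity) (fun h x => add_nonneg (hX0 _ _) (n3 _ _)),
    energy_add m2 (fun _ _ => hX0 _ _) n3, energy_const_mul (by positivity),
    energy_const_mul (by positivity), energy_sum_shift hDm hD0 e 15 fun i => (i : ℝ) - 8,
    energy_shift (fun h x => X (16 * h) x) fun h => (-8 * h) • e]
  gcongr ?_ + ?_
  · rw [hθdef, ENNReal.ofReal_mul (by positivity), mul_assoc]
    gcongr
    exact energy_dilate_le one_le_two hη.le W
  · rw [hc, ← mul_assoc, mul_add, add_mul _ _ (energy s η X), add_mul _ _ (energy s η D)]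
    refine add_le_add ?_ ?_
    · exact (energy_dilate_le (by norm_num) hη.le X).trans le_self_add
    · exact le_add_self

/-- The directional form of the estimate for `|f| ^ β` in terms of difference energies. -/
theorem exists_energy_stepDiff_abs_rpow_le {s M β : ℝ} (hs : 0 < s) (hβ : 1 < β)
    (hsβ : s < β + 1 / 2) (hM : 0 ≤ M) {K : ℕ} (hK : 2 ≤ K) :
    ∃ (N : ℕ) (C : ℝ≥0∞), K ≤ N ∧ C ≠ ⊤ ∧ ∀ (e : E3) (f : E3 → ℝ), IsBddL2 M f →
      energy s 0 (fun h x => stepDiff e N (fun y => |f y| ^ β) h x ^ 2) ≤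
        C * energy s 0 (fun h x => stepDiff e K f h x ^ 2) := by
  obtain ⟨L, hL, hLs⟩ : ∃ L : ℕ, β < L ∧ ((37 / 25 : ℝ)⁻¹ ^ L) ^ 2 * 2 ^ (2 * s) < 1 := by
    have h1 : Filter.Tendsto (fun L : ℕ => ((37 / 25 : ℝ)⁻¹ ^ L) ^ 2 * 2 ^ (2 * s)) Filter.atTop
        (nhds (0 ^ 2 * 2 ^ (2 * s))) :=
      ((tendsto_pow_atTop_nhds_zero_of_lt_one (by norm_num) (by norm_num)).pow 2).mul_const _
    have h2 := h1.eventually_lt_const (show (0 : ℝ) ^ 2 * 2 ^ (2 * s) < 1 by simp)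
    have h3 := (tendsto_natCast_atTop_atTop (R := ℝ)).eventually_gt_atTop β
    obtain ⟨L, h⟩ := (h3.and h2).exists
    exact ⟨L, h⟩
  set N := max K ((L - 1) * (K - 1) + 1) with hN
  have hKN : K ≤ N := le_max_left _ _
  have hLN : (L - 1) * (K - 1) < N := lt_of_lt_of_le (Nat.lt_succ_self _) (le_max_right _ _)
  obtain ⟨C₀, hC₀, hpt⟩ := exists_abs_fwdDiff_abs_rpow_le hβ hM hK hL hLN hKN
  obtain ⟨C₁, hC₁, h₁⟩ := exists_energy_crossing_le hs hβ hsβ hM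
  obtain ⟨C₂, hC₂, h₂⟩ := exists_energy_damped_le hs hβ hL hLs hM
  have h₃ : ∀ k : ℕ, ∃ C : ℝ≥0∞, C ≠ ⊤ ∧ (2 ≤ k → k ≤ K → ∀ (e : E3) (f : E3 → ℝ) (η : ℝ),
      0 < η → IsBddL2 M f → energy s η (fun h x => |stepDiff e k f h x| ^ (2 * β)) ≤
        C * energy s η (fun h x => stepDiff e K f h x ^ 2)) := by
    intro k
    by_cases hk : 2 ≤ k ∧ k ≤ K
    · have hk2 : (2 : ℝ) ≤ k := by exact_mod_cast hk.1
      obtain ⟨C, hC, h⟩ := exists_energy_stepDiff_rpow_le hs (by linarith : 2 ≤ 2 * β) hM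
        (k := k) (K := K) (by nlinarith) hk.2
      exact ⟨C, hC, fun _ _ => h⟩
    · exact ⟨0, ENNReal.zero_ne_top, fun a b => absurd ⟨a, b⟩ hk⟩
  choose C₃ hC₃ h₃ using h₃
  set c : ℝ := C₀ ^ 2 * (3 * (N + 1)) with hc
  set T : ℝ≥0∞ := ENNReal.ofReal c * (∑ k ∈ Finset.Ico K (N + 1),
      ENNReal.ofReal ((2 ^ (k - K)) ^ 2 * ((k - K : ℕ) + 1)) * ((k - K + 1 : ℕ) : ℝ≥0∞) +
      ∑ k ∈ Finset.Ico 2 K, C₃ k + C₂ * (C₁ * C₃ 2 + C₃ 2)) with hT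
  refine ⟨N, T, hKN, ?_, fun e f hf => energy_zero_le fun η hη => ?_⟩
  · have := hC₃ 2
    refine ENNReal.mul_ne_top ENNReal.ofReal_ne_top (ENNReal.add_ne_top.2
      ⟨ENNReal.add_ne_top.2 ⟨?_, ?_⟩, ?_⟩)
    · exact ENNReal.sum_ne_top.2 fun k _ =>
        ENNReal.mul_ne_top ENNReal.ofReal_ne_top (ENNReal.natCast_ne_top _)
    · exact ENNReal.sum_ne_top.2 fun k _ => hC₃ k
    · exact ENNReal.mul_ne_top hC₂ (ENNReal.add_ne_top.2 ⟨ENNReal.mul_ne_top hC₁ this, this⟩)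
  have hfm := hf.measurable
  have hpt' : ∀ h x, stepDiff e N (fun y => |f y| ^ β) h x ^ 2 ≤
      c * (∑ k ∈ Finset.Ico K (N + 1), stepDiff e k f h x ^ 2 +
        ∑ k ∈ Finset.Ico 2 K, |stepDiff e k f h x| ^ (2 * β) +
        damped β L (f x) (stepDiff e 1 f h x) ^ 2) := by
    intro h x
    have hA := hpt (fun n : ℕ => f (x + n • h • e)) fun n => hf.abs_le _
    simp only [← fwdDiff_iter_apply_eq_seq (h • e) f _ x, zero_smul, add_zero] at hA
    rw [← fwdDiff_iter_apply_eq_seq (h • e) (fun y => |f y| ^ β) N x] at hA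
    change |stepDiff e N (fun y => |f y| ^ β) h x| ≤ C₀ * (∑ k ∈ Finset.Ico K (N + 1),
      |stepDiff e k f h x| + ∑ k ∈ Finset.Ico 2 K, |stepDiff e k f h x| ^ β +
      damped β L (f x) (stepDiff e 1 f h x)) at hA
    set a := ∑ k ∈ Finset.Ico K (N + 1), |stepDiff e k f h x| with ha
    set b := ∑ k ∈ Finset.Ico 2 K, |stepDiff e k f h x| ^ β with hb
    set d := damped β L (f x) (stepDiff e 1 f h x) with hd
    have ha2 : a ^ 2 ≤ (N + 1) * ∑ k ∈ Finset.Ico K (N + 1), stepDiff e k f h x ^ 2 := by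
      refine sq_sum_le_card_mul_sum_sq.trans ?_
      simp only [sq_abs]
      gcongr
      rw [Nat.card_Ico]
      exact_mod_cast Nat.sub_le _ _
    have hb2 : b ^ 2 ≤ (N + 1) * ∑ k ∈ Finset.Ico 2 K, |stepDiff e k f h x| ^ (2 * β) := by
      refine sq_sum_le_card_mul_sum_sq.trans ?_
      have : ∀ k, (|stepDiff e k f h x| ^ β) ^ 2 = |stepDiff e k f h x| ^ (2 * β) := fun k => by
        rw [← Real.rpow_natCast, ← Real.rpow_mul (abs_nonneg _)]; congr 1; ring
      simp only [this]
      gcongr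
      rw [Nat.card_Ico]
      exact_mod_cast (show K - 2 ≤ N + 1 by omega)
    have hd2 : d ^ 2 ≤ (N + 1) * d ^ 2 := by
      nlinarith [sq_nonneg d, (Nat.cast_nonneg N : (0 : ℝ) ≤ N)]
    have h3 : (a + b + d) ^ 2 ≤ 3 * (a ^ 2 + b ^ 2 + d ^ 2) := by
      nlinarith [sq_nonneg (a - b), sq_nonneg (b - d), sq_nonneg (a - d)]
    rw [← sq_abs]
    calc _ ≤ (C₀ * (a + b + d)) ^ 2 := pow_le_pow_left₀ (abs_nonneg _) hA 2
      _ = C₀ ^ 2 * (a + b + d) ^ 2 := by ring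
      _ ≤ C₀ ^ 2 * (3 * ((N + 1) * ∑ k ∈ Finset.Ico K (N + 1), stepDiff e k f h x ^ 2 +
        (N + 1) * ∑ k ∈ Finset.Ico 2 K, |stepDiff e k f h x| ^ (2 * β) + (N + 1) * d ^ 2)) := by
          gcongr
          exact h3.trans (by gcongr)
      _ = _ := by rw [hc]; ring
  refine (energy_mono hpt').trans ?_
  have m1 : ∀ k, Measurable (Function.uncurry fun h x => stepDiff e k f h x ^ 2) := fun k =>
    (measurable_stepDiff hfm e k).pow_const 2
  have m2 : ∀ k, Measurable (Function.uncurry fun h x => |stepDiff e k f h x| ^ (2 * β)) := fun k =>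
    (measurable_stepDiff hfm e k).abs.pow_const _
  have m1' : Measurable (Function.uncurry fun h x =>
      ∑ k ∈ Finset.Ico K (N + 1), stepDiff e k f h x ^ 2) :=
    Finset.measurable_fun_sum _ fun k _ => m1 k
  have m2' : Measurable (Function.uncurry fun h x =>
      ∑ k ∈ Finset.Ico 2 K, |stepDiff e k f h x| ^ (2 * β)) :=
    Finset.measurable_fun_sum _ fun k _ => m2 k
  have m12 : Measurable (Function.uncurry fun h x =>
      ∑ k ∈ Finset.Ico K (N + 1), stepDiff e k f h x ^ 2 +
        ∑ k ∈ Finset.Ico 2 K, |stepDiff e k f h x| ^ (2 * β)) := m1'.add m2'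
  rw [energy_const_mul (by positivity), energy_add m12 (fun _ _ => by positivity)
    (fun _ _ => by positivity), energy_add m1' (fun _ _ => by positivity)
    (fun _ _ => by positivity), energy_sum _ m1 (fun _ _ _ => by positivity),
    energy_sum _ m2 (fun _ _ _ => by positivity)]
  set I := energy s η (fun h x => stepDiff e K f h x ^ 2) with hI
  have hE2 := h₃ 2 le_rfl hK e f η hη hf
  calc _ ≤ ENNReal.ofReal c * (∑ k ∈ Finset.Ico K (N + 1),
      ENNReal.ofReal ((2 ^ (k - K)) ^ 2 * ((k - K : ℕ) + 1)) * ((k - K + 1 : ℕ) : ℝ≥0∞) * I +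
      ∑ k ∈ Finset.Ico 2 K, C₃ k * I + C₂ * (C₁ * (C₃ 2 * I) + C₃ 2 * I)) := by
        gcongr with k hk k hk
        · have hk' := Finset.mem_Ico.1 hk
          have := energy_stepDiff_add_le (s := s) (η := η) hfm e K (k - K)
          rw [Nat.add_sub_cancel' hk'.1] at this
          rw [mul_assoc]
          exact this
        · have hk' := Finset.mem_Ico.1 hk
          exact h₃ k hk'.1 hk'.2.le e f η hη hf
        · refine (h₂ e f η hη hf).trans ?_
          gcongr
          refine (h₁ e f η hη hf).trans ?_
          gcongr
    _ = T * I := by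
        rw [hT, ← Finset.sum_mul, ← Finset.sum_mul]; ring
    _ ≤ _ := by
        gcongr
        exact energy_anti hη.le _

lemma fourier_toLp_ae_eq {f : E3 → ℂ} (h1 : Integrable f) (h2 : MemLp f 2) :
    (𝓕 (h2.toLp f) : Lp ℂ 2 (volume : Measure E3)) =ᵐ[volume] 𝓕 f := by
  refine ae_eq_of_integral_contDiff_smul_eq ((Lp.memLp _).locallyIntegrable (by norm_num))
    (VectorFourier.fourierIntegral_continuous continuous_fourierChar continuous_inner
      h1).locallyIntegrable fun g hg hgs => ?_
  have hgc : HasCompactSupport fun x => (g x : ℂ) := hgs.comp_left (g := ((↑) : ℝ → ℂ)) (by simp)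
  have hgd : ContDiff ℝ (⊤ : ℕ∞) fun x => (g x : ℂ) := Complex.ofRealCLM.contDiff.comp hg
  set φ := hgc.toSchwartzMap hgd with hφ
  have e1 := congrArg (fun T => T φ) (Lp.fourier_toTemperedDistribution_eq (h2.toLp f))
  simp only [TemperedDistribution.fourier_apply, Lp.toTemperedDistribution_apply] at e1
  have e2 : ∫ x, (𝓕 φ) x • f x = ∫ x, φ x • 𝓕 f x := by
    simpa using! VectorFourier.integral_fourierIntegral_smul_eq_flip (L := innerₗ E3)
      continuous_fourierChar continuous_inner φ.integrable h1
  have e3 : ∫ x, (𝓕 φ) x • (h2.toLp f) x = ∫ x, (𝓕 φ) x • f x := by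
    refine integral_congr_ae ?_
    filter_upwards [h2.coeFn_toLp] with x hx
    rw [hx]
  have e4 : ∀ x, φ x = (g x : ℂ) := fun x => rfl
  rw [e3, e2] at e1
  simp only [e4, Complex.coe_smul] at e1
  exact e1.symm

/-- Plancherel's theorem for integrable, square integrable functions. -/
lemma lintegral_enorm_fourier_sq {f : E3 → ℂ} (h1 : Integrable f) (h2 : MemLp f 2) :
    ∫⁻ ξ, ‖𝓕 f ξ‖ₑ ^ 2 = ∫⁻ x, ‖f x‖ₑ ^ 2 := by
  have key : ∀ g : E3 → ℂ, ∫⁻ x, ‖g x‖ₑ ^ 2 = eLpNorm g 2 volume ^ 2 := by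
    intro g
    have := eLpNorm_nnreal_pow_eq_lintegral (μ := volume) (f := g) (p := 2) (by norm_num)
    simpa using this.symm
  rw [key, key, ← eLpNorm_congr_ae (fourier_toLp_ae_eq h1 h2), ← Lp.enorm_def,
    ← ofReal_norm, Lp.norm_fourier_eq, ofReal_norm, Lp.enorm_def, eLpNorm_congr_ae h2.coeFn_toLp]

lemma norm_fourierChar_sub_one (t : ℝ) : ‖(𝐞 t : ℂ) - 1‖ = |2 * Real.sin (π * t)| := by
  rw [Real.fourierChar_apply]
  have := Complex.norm_exp_I_mul_ofReal_sub_one (2 * π * t)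
  rw [mul_comm] at this
  rw [this, Real.norm_eq_abs]
  congr 3
  ring

lemma fourier_fwdDiff_iter {g : E3 → ℂ} (hg : Integrable g) (v ξ : E3) (k : ℕ) :
    𝓕 (Δ_[v] ^[k] g) ξ = ((𝐞 (inner ℝ v ξ) : ℂ) - 1) ^ k * 𝓕 g ξ := by
  induction k generalizing g with
  | zero => simp
  | succ k ih =>
    have h1 : Integrable fun x => g (x + v) := hg.comp_add_right v
    have h2 : Δ_[v] g = (fun x => g (x + v)) - g := rfl
    have h3 : 𝓕 (fun x => g (x + v)) ξ = (𝐞 (inner ℝ v ξ) : ℂ) * 𝓕 g ξ := by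
      have := congrFun (VectorFourier.fourierIntegral_comp_add_right 𝐞 volume (innerₗ E3) g v) ξ
      simpa [Circle.smul_def] using! this
    have h4 : 𝓕 (Δ_[v] g) ξ = ((𝐞 (inner ℝ v ξ) : ℂ) - 1) * 𝓕 g ξ := by
      rw [sub_mul, one_mul, ← h3, h2]
      simp only [Real.fourier_eq, Pi.sub_apply, smul_sub]
      exact integral_sub ((Real.fourierIntegral_convergent_iff ξ).2 h1)
        ((Real.fourierIntegral_convergent_iff ξ).2 hg)
    rw [Function.iterate_succ_apply, ih (g := Δ_[v] g) (h2 ▸ h1.sub hg), h4]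
    ring

lemma ofReal_fwdDiff_iter (v : E3) (k : ℕ) (f : E3 → ℝ) (x : E3) :
    ((Δ_[v] ^[k] f x : ℝ) : ℂ) = Δ_[v] ^[k] (fun y => (f y : ℂ)) x := by
  induction k generalizing f with
  | zero => rfl
  | succ k ih =>
    have h1 : (fun y => ((Δ_[v] f y : ℝ) : ℂ)) = Δ_[v] fun y => (f y : ℂ) := by
      ext y
      simp [fwdDiff]
    rw [Function.iterate_succ_apply, Function.iterate_succ_apply, ih, h1]

lemma memLp_fwdDiff_iter {p : ℝ≥0∞} {g : E3 → ℂ} (hg : MemLp g p) (v : E3) (k : ℕ) :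
    MemLp (Δ_[v] ^[k] g) p := by
  induction k generalizing g with
  | zero => exact hg
  | succ k ih =>
    rw [Function.iterate_succ_apply]
    exact ih ((hg.comp_measurePreserving (measurePreserving_add_right volume v)).sub hg)

lemma lintegral_stepDiff_sq {f : E3 → ℝ} (h1 : Integrable f) (h2 : MemLp f 2) (e : E3) (k : ℕ)
    (t : ℝ) : ∫⁻ x, ENNReal.ofReal (stepDiff e k f t x ^ 2) =
      ∫⁻ ξ, ENNReal.ofReal ((2 * Real.sin (π * (t * inner ℝ e ξ))) ^ (2 * k)) *
        ‖𝓕 (fun x => (f x : ℂ)) ξ‖ₑ ^ 2 := by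
  have h1' : Integrable fun x => (f x : ℂ) := h1.ofReal
  have h2' : MemLp (fun x => (f x : ℂ)) 2 := h2.ofReal
  have hp := lintegral_enorm_fourier_sq
    (memLp_one_iff_integrable.1 (memLp_fwdDiff_iter (memLp_one_iff_integrable.2 h1') (t • e) k))
    (memLp_fwdDiff_iter h2' (t • e) k)
  calc _ = ∫⁻ x, ‖Δ_[t • e] ^[k] (fun y => (f y : ℂ)) x‖ₑ ^ 2 := by
        refine lintegral_congr fun x => ?_
        rw [← ofReal_fwdDiff_iter, ← ofReal_norm, ← ENNReal.ofReal_pow (norm_nonneg _),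
          Complex.norm_real, Real.norm_eq_abs, sq_abs]
        rfl
    _ = _ := by
        rw [← hp]
        refine lintegral_congr fun ξ => ?_
        rw [fourier_fwdDiff_iter h1', enorm_mul, mul_pow]
        congr 1
        rw [← ofReal_norm, norm_pow, norm_fourierChar_sub_one, real_inner_smul_left,
          ← ENNReal.ofReal_pow (by positivity), ← pow_mul, mul_comm k 2, pow_mul, sq_abs, ← pow_mul]

end

/-- The total mass of `(2 sin (π t)) ^ (2 k)` with respect to `t ^ (-1 - 2 * s) dt`. -/
def sinMoment (s : ℝ) (k : ℕ) : ℝ≥0∞ :=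
  ∫⁻ t in Ioi (0 : ℝ), ENNReal.ofReal (t ^ (-1 - 2 * s)) *
    ENNReal.ofReal ((2 * Real.sin (π * t)) ^ (2 * k))

lemma sinMoment_ne_zero (s : ℝ) (k : ℕ) : sinMoment s k ≠ 0 := by
  have hm : Measurable fun t : ℝ => ENNReal.ofReal (t ^ (-1 - 2 * s)) *
      ENNReal.ofReal ((2 * Real.sin (π * t)) ^ (2 * k)) := by fun_prop
  have h : 0 < ∫⁻ t in Ioo (0 : ℝ) 1, ENNReal.ofReal (t ^ (-1 - 2 * s)) *
      ENNReal.ofReal ((2 * Real.sin (π * t)) ^ (2 * k)) := by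
    rw [setLIntegral_pos_iff hm]
    refine lt_of_lt_of_le (b := volume (Ioo (0 : ℝ) 1)) (by simp) (measure_mono fun t ht => ⟨?_, ht⟩)
    have h1 : 0 < Real.sin (π * t) :=
      Real.sin_pos_of_pos_of_lt_pi (mul_pos pi_pos ht.1) (by nlinarith [ht.2, pi_pos])
    have h2 : 0 < t ^ (-1 - 2 * s) := Real.rpow_pos_of_pos ht.1 _
    rw [Function.mem_support, ← ENNReal.ofReal_mul h2.le]
    exact (ENNReal.ofReal_pos.2 (by positivity)).ne'
  exact (h.trans_le (lintegral_mono_set Ioo_subset_Ioi_self)).ne'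

lemma sinMoment_ne_top {s : ℝ} (hs : 0 < s) {k : ℕ} (hk : s < k) : sinMoment s k ≠ ⊤ := by
  unfold sinMoment
  rw [← Ioc_union_Ioi_eq_Ioi zero_le_one, lintegral_union measurableSet_Ioi
    (Ioc_disjoint_Ioi le_rfl)]
  refine ENNReal.add_ne_top.2 ⟨?_, ?_⟩
  · have h1 : IntegrableOn (fun t : ℝ => (2 * π) ^ (2 * k) * t ^ (2 * k - 1 - 2 * s)) (Ioc 0 1) := by
      refine Integrable.const_mul ?_ _
      rw [← IntegrableOn, ← intervalIntegrable_iff_integrableOn_Ioc_of_le zero_le_one]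
      exact intervalIntegral.intervalIntegrable_rpow' (by linarith)
    refine ne_top_of_le_ne_top h1.lintegral_lt_top.ne (setLIntegral_mono' measurableSet_Ioc ?_)
    intro t ht
    rw [← ENNReal.ofReal_mul (Real.rpow_nonneg ht.1.le _)]
    refine ENNReal.ofReal_le_ofReal ?_
    have h2 : (2 * Real.sin (π * t)) ^ (2 * k) ≤ (2 * (π * t)) ^ (2 * k) := by
      rw [pow_mul, pow_mul]
      refine pow_le_pow_left₀ (sq_nonneg _) (sq_le_sq.2 ?_) k
      rw [abs_mul, abs_mul 2 (π * t)]
      exact mul_le_mul_of_nonneg_left Real.abs_sin_le_abs (abs_nonneg _)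
    have h3 : t ^ (2 * k - 1 - 2 * s) = t ^ (-1 - 2 * s) * t ^ (2 * k) := by
      rw [← Real.rpow_natCast t, ← Real.rpow_add ht.1]
      congr 1; push_cast; ring
    rw [h3]
    calc _ ≤ t ^ (-1 - 2 * s) * (2 * (π * t)) ^ (2 * k) :=
          mul_le_mul_of_nonneg_left h2 (Real.rpow_nonneg ht.1.le _)
      _ = _ := by rw [← mul_assoc, mul_pow]; ring
  · have h1 : IntegrableOn (fun t : ℝ => 2 ^ (2 * k) * t ^ (-1 - 2 * s)) (Ioi 1) :=
      Integrable.const_mul (integrableOn_Ioi_rpow_of_lt (by linarith) one_pos) _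
    refine ne_top_of_le_ne_top h1.lintegral_lt_top.ne (setLIntegral_mono' measurableSet_Ioi ?_)
    intro t ht
    have ht0 : 0 < t := lt_trans one_pos ht
    rw [← ENNReal.ofReal_mul (Real.rpow_nonneg ht0.le _)]
    refine ENNReal.ofReal_le_ofReal ?_
    rw [mul_comm]
    gcongr ?_ * _
    rw [pow_mul, pow_mul]
    refine pow_le_pow_left₀ (sq_nonneg _) (sq_le_sq.2 ?_) k
    rw [abs_mul]
    nlinarith [Real.abs_sin_le_one (π * t), abs_nonneg (Real.sin (π * t)), abs_two (α := ℝ)]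

lemma lintegral_rpow_mul_comp_mul {s K : ℝ} (hK : 0 < K) (G : ℝ → ℝ≥0∞) :
    ∫⁻ t in Ioi (0 : ℝ), ENNReal.ofReal (t ^ (-1 - 2 * s)) * G (K * t) =
      ENNReal.ofReal (K ^ (2 * s)) *
        ∫⁻ t in Ioi (0 : ℝ), ENNReal.ofReal (t ^ (-1 - 2 * s)) * G t := by
  have himg : (fun t => K * t) '' Ioi 0 = Ioi 0 := by rw [Set.image_mul_left_Ioi hK, mul_zero]
  conv_rhs => rw [← himg]
  rw [lintegral_image_eq_lintegral_abs_deriv_mul (f' := fun _ => K) measurableSet_Ioi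
    (fun x _ => by simpa using ((hasDerivAt_id x).const_mul K).hasDerivWithinAt)
    (mul_right_injective₀ hK.ne').injOn, ← lintegral_const_mul' _ _ ENNReal.ofReal_ne_top]
  refine setLIntegral_congr_fun measurableSet_Ioi fun t ht => ?_
  have ht0 : 0 < t := ht
  rw [← mul_assoc, ← mul_assoc, ← ENNReal.ofReal_mul (by positivity),
    ← ENNReal.ofReal_mul (by positivity), abs_of_pos hK, Real.mul_rpow hK.le ht0.le]
  congr 2
  rw [Real.rpow_sub hK, Real.rpow_neg_one]
  field_simp

lemma lintegral_rpow_mul_sin {s : ℝ} (hs : 0 < s) {k : ℕ} (hk : k ≠ 0) (a : ℝ) :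
    ∫⁻ t in Ioi (0 : ℝ), ENNReal.ofReal (t ^ (-1 - 2 * s)) *
      ENNReal.ofReal ((2 * Real.sin (π * (t * a))) ^ (2 * k)) =
      ENNReal.ofReal (|a| ^ (2 * s)) * sinMoment s k := by
  rcases eq_or_ne a 0 with rfl | ha
  · simp [hk, Real.zero_rpow (by positivity : 2 * s ≠ 0)]
  · rw [sinMoment, ← lintegral_rpow_mul_comp_mul (abs_pos.2 ha)
      fun t => ENNReal.ofReal ((2 * Real.sin (π * t)) ^ (2 * k))]
    refine lintegral_congr fun t => ?_
    congr 2
    rw [pow_mul, pow_mul]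
    congr 1
    rcases abs_choice a with h | h <;> rw [h]
    · ring_nf
    · rw [show π * (-a * t) = -(π * (t * a)) by ring, Real.sin_neg]; ring

/-- Difference energies on the Fourier side. -/
lemma energy_stepDiff_sq_eq {s : ℝ} (hs : 0 < s) {k : ℕ} (hk : k ≠ 0) {f : E3 → ℝ}
    (h1 : Integrable f) (h2 : MemLp f 2) (e : E3) :
    energy s 0 (fun h x => stepDiff e k f h x ^ 2) = sinMoment s k *
      ∫⁻ ξ, ENNReal.ofReal (|inner ℝ e ξ| ^ (2 * s)) * ‖𝓕 (fun x => (f x : ℂ)) ξ‖ₑ ^ 2 := by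
  have hF : Measurable (𝓕 (fun x => (f x : ℂ))) :=
    (VectorFourier.fourierIntegral_continuous continuous_fourierChar continuous_inner
      h1.ofReal).measurable
  unfold energy
  simp_rw [lintegral_stepDiff_sq h1 h2, ← lintegral_const_mul' _ _ ENNReal.ofReal_ne_top]
  rw [lintegral_lintegral_swap (by fun_prop), ← lintegral_const_mul _ (by fun_prop)]
  refine lintegral_congr fun ξ => ?_
  simp only [← mul_assoc (ENNReal.ofReal _) (ENNReal.ofReal _)]
  rw [lintegral_mul_const _ (by fun_prop), lintegral_rpow_mul_sin hs hk]
  ring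

lemma one_add_norm_sq_rpow_le {s : ℝ} (hs : 0 < s) (ξ : E3) :
    (1 + ‖ξ‖ ^ 2) ^ s ≤ 4 ^ s * (1 + ∑ i, |ξ i| ^ (2 * s)) := by
  have h1 : ‖ξ‖ ^ 2 = ∑ i, |ξ i| ^ 2 := by rw [EuclideanSpace.norm_sq_eq]; simp
  have h2 : ∀ t : ℝ, |t| ^ (2 * s) = (|t| ^ 2) ^ s := fun t => by
    rw [← Real.rpow_natCast, ← Real.rpow_mul (abs_nonneg _)]; norm_num
  simp_rw [h2]
  have h3 : ∀ b : ℝ, 0 ≤ b → 1 + ‖ξ‖ ^ 2 ≤ 4 * b → b ^ s ≤ 1 + ∑ i, (|ξ i| ^ 2) ^ s →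
      (1 + ‖ξ‖ ^ 2) ^ s ≤ 4 ^ s * (1 + ∑ i, (|ξ i| ^ 2) ^ s) := fun b hb hb1 hb2 => by
    calc _ ≤ (4 * b) ^ s := by gcongr
      _ = 4 ^ s * b ^ s := Real.mul_rpow (by norm_num) hb
      _ ≤ _ := by gcongr
  by_cases h : ∃ i, 1 + ‖ξ‖ ^ 2 ≤ 4 * |ξ i| ^ 2
  · obtain ⟨i, hi⟩ := h
    refine h3 _ (by positivity) hi ?_
    have := Finset.single_le_sum (f := fun i => (|ξ i| ^ 2) ^ s) (fun _ _ => by positivity)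
      (Finset.mem_univ i)
    simp only at this
    linarith
  · push Not at h
    refine h3 1 zero_le_one ?_ ?_
    · have h0 := h 0
      have h1' := h 1
      have h2' := h 2
      rw [Fin.sum_univ_three] at h1
      linarith
    · rw [Real.one_rpow]
      exact le_add_of_nonneg_right (Finset.sum_nonneg fun _ _ => by positivity)

lemma abs_apply_rpow_le {s : ℝ} (hs : 0 < s) (ξ : E3) (i : Fin 3) :
    |ξ i| ^ (2 * s) ≤ (1 + ‖ξ‖ ^ 2) ^ s := by
  rw [Real.rpow_mul (abs_nonneg _), Real.rpow_two]
  gcongr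
  have := pow_le_pow_left₀ (norm_nonneg (ξ i)) (PiLp.norm_apply_le ξ i) 2
  rw [Real.norm_eq_abs] at this
  linarith

lemma lintegral_enorm_fourier_sq_le_HsNormSq {s : ℝ} (hs : 0 < s) (f : E3 → ℂ) :
    ∫⁻ ξ, ‖𝓕 f ξ‖ₑ ^ 2 ≤ HsNormSq s f := by
  refine lintegral_mono fun ξ => ?_
  rw [← enorm_eq_nnnorm]
  conv_lhs => rw [← one_mul (‖𝓕 f ξ‖ₑ ^ 2)]
  gcongr
  rw [ENNReal.one_le_ofReal]
  exact Real.one_le_rpow (by nlinarith [norm_nonneg ξ]) hs.le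

lemma lintegral_apply_rpow_le_HsNormSq {s : ℝ} (hs : 0 < s) (f : E3 → ℂ) (i : Fin 3) :
    ∫⁻ ξ : E3, ENNReal.ofReal (|ξ i| ^ (2 * s)) * ‖𝓕 f ξ‖ₑ ^ 2 ≤ HsNormSq s f := by
  refine lintegral_mono fun ξ => ?_
  rw [← enorm_eq_nnnorm]
  gcongr
  exact abs_apply_rpow_le hs ξ i

lemma HsNormSq_le {s : ℝ} (hs : 0 < s) {f : E3 → ℂ} (hf : Integrable f) :
    HsNormSq s f ≤ ENNReal.ofReal (4 ^ s) * ((∫⁻ ξ, ‖𝓕 f ξ‖ₑ ^ 2) +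
      ∑ i, ∫⁻ ξ : E3, ENNReal.ofReal (|ξ i| ^ (2 * s)) * ‖𝓕 f ξ‖ₑ ^ 2) := by
  have hF : Measurable (𝓕 f) :=
    (VectorFourier.fourierIntegral_continuous continuous_fourierChar continuous_inner hf).measurable
  rw [← lintegral_finsetSum _ fun i _ => by fun_prop, ← lintegral_add_left (by fun_prop),
    ← lintegral_const_mul _ (by fun_prop)]
  refine lintegral_mono fun ξ => ?_
  rw [← enorm_eq_nnnorm, ← Finset.sum_mul]
  calc _ ≤ ENNReal.ofReal (4 ^ s * (1 + ∑ i, |ξ i| ^ (2 * s))) * ‖𝓕 f ξ‖ₑ ^ 2 := by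
        gcongr
        exact one_add_norm_sq_rpow_le hs ξ
    _ = _ := by
        rw [ENNReal.ofReal_mul (by positivity), ENNReal.ofReal_add zero_le_one
          (Finset.sum_nonneg fun _ _ => by positivity), ENNReal.ofReal_one,
          ENNReal.ofReal_sum_of_nonneg fun _ _ => by positivity]
        ring

lemma abs_rpow_le_mul_abs {β M t : ℝ} (hβ : 1 < β) (ht : |t| ≤ M) :
    |t| ^ β ≤ M ^ (β - 1) * |t| := by
  rcases eq_or_ne t 0 with rfl | h0
  · simp [Real.zero_rpow (by linarith : β ≠ 0)]
  · have := abs_pos.2 h0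
    calc |t| ^ β = |t| ^ (β - 1) * |t| := by
          rw [← Real.rpow_add_one this.ne']; congr 1; ring
      _ ≤ _ := by gcongr

lemma lintegral_ofReal_sq {f : E3 → ℝ} :
    ∫⁻ x, ENNReal.ofReal (f x ^ 2) = ∫⁻ x, ‖(f x : ℂ)‖ₑ ^ 2 := by
  refine lintegral_congr fun x => ?_
  rw [← ofReal_norm, ← ENNReal.ofReal_pow (norm_nonneg _), Complex.norm_real, Real.norm_eq_abs,
    sq_abs]

/-- The estimate for `|f| ^ β` in the unweighted space `H^s`. -/
theorem exists_HsNormSq_abs_rpow_le {s M β : ℝ} (hs : 0 < s) (hβ : 1 < β)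
    (hsβ : s < β + 1 / 2) (hM : 0 ≤ M) :
    ∃ C : ℝ≥0∞, C ≠ ⊤ ∧ ∀ f : E3 → ℝ, Measurable f → (∀ x, |f x| ≤ M) → Integrable f → MemLp f 2 →
      HsNormSq s (fun x => ((|f x| ^ β : ℝ) : ℂ)) ≤ C * HsNormSq s (fun x => (f x : ℂ)) := by
  obtain ⟨K₀, hK₀⟩ := exists_nat_gt s
  set K := max 2 K₀ with hKdef
  have hK2 : 2 ≤ K := le_max_left _ _
  have hKs : s < K := hK₀.trans_le (by exact_mod_cast le_max_right _ _)
  obtain ⟨N, C₁, hN, hC₁, hmain⟩ := exists_energy_stepDiff_abs_rpow_le hs hβ hsβ hM hK2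
  refine ⟨ENNReal.ofReal (4 ^ s) * (ENNReal.ofReal ((M ^ (β - 1)) ^ 2) +
    ∑ i : Fin 3, (sinMoment s N)⁻¹ * (C₁ * sinMoment s K)), ?_, ?_⟩
  · refine ENNReal.mul_ne_top ENNReal.ofReal_ne_top (ENNReal.add_ne_top.2
      ⟨ENNReal.ofReal_ne_top, ENNReal.sum_ne_top.2 fun _ _ => ENNReal.mul_ne_top
        (ENNReal.inv_ne_top.2 (sinMoment_ne_zero s N))
        (ENNReal.mul_ne_top hC₁ (sinMoment_ne_top hs hKs))⟩)
  intro f hfm hfM hf1 hf2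
  set g : E3 → ℝ := fun x => |f x| ^ β with hg
  have hgm : Measurable g := by fun_prop
  have hgf : ∀ x, ‖g x‖ ≤ ‖M ^ (β - 1) * f x‖ := fun x => by
    rw [norm_mul, Real.norm_of_nonneg (by positivity), Real.norm_of_nonneg (by positivity)]
    exact abs_rpow_le_mul_abs hβ (hfM x)
  have hg1 : Integrable g :=
    (hf1.const_mul (M ^ (β - 1))).mono hgm.aestronglyMeasurable (ae_of_all _ hgf)
  have hg2 : MemLp g 2 :=
    (hf2.const_mul (M ^ (β - 1))).mono hgm.aestronglyMeasurable (ae_of_all _ hgf)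
  have hf1' : Integrable fun x => (f x : ℂ) := hf1.ofReal
  have hf2' : MemLp (fun x => (f x : ℂ)) 2 := hf2.ofReal
  have hg1' : Integrable fun x => (g x : ℂ) := hg1.ofReal
  have hg2' : MemLp (fun x => (g x : ℂ)) 2 := hg2.ofReal
  have hbdd : IsBddL2 M f := ⟨hfm, hfM, by
    exact hf2.integrable_sq.lintegral_lt_top.ne⟩
  refine (HsNormSq_le hs hg1').trans ?_
  rw [mul_assoc, add_mul, Finset.sum_mul]
  gcongr with i
  · rw [lintegral_enorm_fourier_sq hg1' hg2', ← lintegral_ofReal_sq]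
    calc _ ≤ ∫⁻ x, ENNReal.ofReal ((M ^ (β - 1)) ^ 2) * ENNReal.ofReal (f x ^ 2) := by
          refine lintegral_mono fun x => ?_
          rw [← ENNReal.ofReal_mul (by positivity), ← mul_pow]
          exact ENNReal.ofReal_le_ofReal (sq_le_sq.2 (hgf x))
      _ = ENNReal.ofReal ((M ^ (β - 1)) ^ 2) * ∫⁻ ξ, ‖𝓕 (fun x => (f x : ℂ)) ξ‖ₑ ^ 2 := by
          rw [lintegral_const_mul' _ _ ENNReal.ofReal_ne_top, lintegral_ofReal_sq,
            lintegral_enorm_fourier_sq hf1' hf2']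
      _ ≤ _ := by
          gcongr
          exact lintegral_enorm_fourier_sq_le_HsNormSq hs _
  · set e : E3 := EuclideanSpace.single i 1 with he
    have hin : ∀ ξ : E3, inner ℝ e ξ = ξ i := fun ξ => by
      simp [he, EuclideanSpace.inner_single_left]
    have h1 := hmain e f hbdd
    rw [energy_stepDiff_sq_eq hs (by omega) hg1 hg2, energy_stepDiff_sq_eq hs (by omega) hf1 hf2] at h1
    simp only [hin] at h1
    have hNtop := sinMoment_ne_top hs (hKs.trans_le (by exact_mod_cast hN : (K : ℝ) ≤ N))
    calc _ = (sinMoment s N)⁻¹ * (sinMoment s N * ∫⁻ ξ : E3, ENNReal.ofReal (|ξ i| ^ (2 * s)) *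
          ‖𝓕 (fun x => (g x : ℂ)) ξ‖ₑ ^ 2) := by
          rw [← mul_assoc, ENNReal.inv_mul_cancel (sinMoment_ne_zero s N) hNtop, one_mul]
      _ ≤ (sinMoment s N)⁻¹ * (C₁ * (sinMoment s K * HsNormSq s (fun x => (f x : ℂ)))) := by
          refine mul_le_mul_right (h1.trans ?_) _
          gcongr
          exact lintegral_apply_rpow_le_HsNormSq hs _ i
      _ = _ := by ring

lemma continuous_fourier_of_integrable {f : E3 → ℂ} (hf : Integrable f) : Continuous (𝓕 f) :=
  VectorFourier.fourierIntegral_continuous continuous_fourierChar continuous_inner hf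

lemma lintegral_mul_sq_le {α : Type*} [MeasurableSpace α] {μ : Measure α} {a b : α → ℝ≥0∞}
    (ha : Measurable a) (hb : Measurable b) :
    (∫⁻ x, a x * b x ∂μ) ^ 2 ≤ (∫⁻ x, a x ∂μ) * ∫⁻ x, a x * b x ^ 2 ∂μ := by
  have h := ENNReal.lintegral_mul_le_Lp_mul_Lq μ Real.HolderConjugate.two_two
    (f := fun x => a x ^ (1 / 2 : ℝ)) (g := fun x => a x ^ (1 / 2 : ℝ) * b x)
    (by fun_prop) (by fun_prop)
  have e0 : ∀ t : ℝ≥0∞, t ^ (1 / 2 : ℝ) * t ^ (1 / 2 : ℝ) = t := fun t => by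
    rw [← ENNReal.rpow_add_of_nonneg _ _ (by norm_num) (by norm_num)]; norm_num
  have e1 : ∀ x, a x ^ (1 / 2 : ℝ) * (a x ^ (1 / 2 : ℝ) * b x) = a x * b x := fun x => by
    rw [← mul_assoc, e0]
  have e2 : ∀ t : ℝ≥0∞, (t ^ (1 / 2 : ℝ)) ^ (2 : ℝ) = t := fun t => by
    rw [← ENNReal.rpow_mul]; norm_num
  simp only [Pi.mul_apply, e1, e2, ENNReal.mul_rpow_of_nonneg _ _ zero_le_two,
    ENNReal.rpow_two] at h
  calc _ ≤ _ := pow_le_pow_left₀ zero_le h 2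
    _ = _ := by rw [mul_pow, sq, sq, e0, e0]

lemma fourier_mul_eq (φ : SchwartzMap E3 ℂ) {g : E3 → ℂ} (hg : Integrable g) (ξ : E3) :
    𝓕 (fun x => φ x * g x) ξ = ∫ η, (𝓕⁻ φ) η * 𝓕 g (ξ + η) := by
  set a : SchwartzMap E3 ℂ := 𝓕⁻ φ with ha
  have hφ : 𝓕 a = φ := FourierTransform.fourier_fourierInv_eq φ
  set k : E3 → ℂ := fun x => 𝐞 (-inner ℝ x ξ) • g x with hk
  have hki : Integrable k := (Real.fourierIntegral_convergent_iff ξ).2 hg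
  have h := VectorFourier.integral_fourierIntegral_smul_eq_flip (L := innerₗ E3)
    continuous_fourierChar continuous_inner (a.integrable (μ := volume)) hki
  have h1 : ∀ x, VectorFourier.fourierIntegral 𝐞 volume (innerₗ E3) a x = φ x := fun x => by
    rw [← hφ]; rfl
  have h2 : ∀ η, VectorFourier.fourierIntegral 𝐞 volume (innerₗ E3).flip k η = 𝓕 g (ξ + η) := by
    intro η
    simp only [VectorFourier.fourierIntegral, Real.fourier_eq, hk]
    refine integral_congr_ae (ae_of_all _ fun x => ?_)
    simp only [smul_smul, ← AddChar.map_add_eq_mul]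
    congr 2
    simp [inner_add_right, real_inner_comm]
  simp only [h1, h2, smul_eq_mul] at h
  rw [← h, Real.fourier_eq]
  refine integral_congr_ae (ae_of_all _ fun x => ?_)
  simp only [hk, Circle.smul_def, smul_eq_mul]
  ring

lemma peetre {s : ℝ} (hs : 0 < s) (ξ η : E3) :
    (1 + ‖ξ‖ ^ 2) ^ s ≤ 2 ^ s * ((1 + ‖η‖ ^ 2) ^ s * (1 + ‖ξ + η‖ ^ 2) ^ s) := by
  rw [← Real.mul_rpow (by positivity) (by positivity), ← Real.mul_rpow (by positivity)
    (by positivity)]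
  gcongr
  have h1 : ‖ξ‖ ≤ ‖ξ + η‖ + ‖η‖ := by simpa using norm_sub_le (ξ + η) η
  have h2 : ‖ξ‖ ^ 2 ≤ (‖ξ + η‖ + ‖η‖) ^ 2 := by gcongr
  nlinarith [sq_nonneg (‖ξ + η‖ - ‖η‖), mul_nonneg (sq_nonneg ‖ξ + η‖) (sq_nonneg ‖η‖)]

/-- Multiplication by a Schwartz function is bounded on `H^s`. -/
lemma HsNormSq_mul_le {s : ℝ} (hs : 0 < s) (φ : SchwartzMap E3 ℂ) {g : E3 → ℂ}
    (hg : Integrable g) :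
    HsNormSq s (fun x => φ x * g x) ≤ ENNReal.ofReal (2 ^ s) *
      (∫⁻ η : E3, ENNReal.ofReal ((1 + ‖η‖ ^ 2) ^ s) * ‖𝓕 φ η‖ₑ) ^ 2 * HsNormSq s g := by
  set a : E3 → ℝ≥0∞ := fun η => ‖(𝓕⁻ φ) η‖ₑ with ha
  set w : E3 → ℝ≥0∞ := fun η => ENNReal.ofReal ((1 + ‖η‖ ^ 2) ^ s) with hw
  set G : E3 → ℝ≥0∞ := fun η => ‖𝓕 g η‖ₑ with hG
  have ham : Measurable a := (𝓕⁻ φ).continuous.measurable.enorm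
  have hwm : Measurable w := by fun_prop
  have hGm : Measurable G := (continuous_fourier_of_integrable hg).measurable.enorm
  have hA : ∫⁻ η, w η * ‖𝓕 φ η‖ₑ = ∫⁻ η, w η * a η := by
    rw [← lintegral_neg_eq_self]
    refine lintegral_congr fun η => ?_
    have : (𝓕⁻ φ) η = (𝓕 φ) (-η) := by
      rw [SchwartzMap.fourierInv_coe, Real.fourierInv_eq_fourier_neg, SchwartzMap.fourier_coe]
    simp only [hw, ha, this, norm_neg]
  rw [hA]
  have hA0 : ∫⁻ η, a η ≤ ∫⁻ η, w η * a η := by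
    refine lintegral_mono fun η => ?_
    conv_lhs => rw [← one_mul (a η)]
    gcongr
    rw [hw, ENNReal.one_le_ofReal]
    exact Real.one_le_rpow (by nlinarith [norm_nonneg η]) hs.le
  have hpt : ∀ ξ, ‖𝓕 (fun x => φ x * g x) ξ‖ₑ ^ 2 ≤
      (∫⁻ η, w η * a η) * ∫⁻ η, a η * G (ξ + η) ^ 2 := by
    intro ξ
    rw [fourier_mul_eq φ hg]
    calc _ ≤ (∫⁻ η, a η * G (ξ + η)) ^ 2 := by
          gcongr
          refine (enorm_integral_le_lintegral_enorm _).trans ?_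
          simp only [enorm_mul]
          exact le_rfl
      _ ≤ _ := (lintegral_mul_sq_le ham (by fun_prop)).trans (by gcongr)
  have hmain : ∫⁻ ξ, w ξ * ∫⁻ η, a η * G (ξ + η) ^ 2 ≤
      ENNReal.ofReal (2 ^ s) * ((∫⁻ η, w η * a η) * HsNormSq s g) := by
    calc _ ≤ ∫⁻ ξ, ∫⁻ η, ENNReal.ofReal (2 ^ s) * ((w η * a η) * (w (ξ + η) * G (ξ + η) ^ 2)) := by
          refine lintegral_mono fun ξ => ?_
          rw [← lintegral_const_mul' _ _ ENNReal.ofReal_ne_top]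
          refine lintegral_mono fun η => ?_
          calc _ ≤ (ENNReal.ofReal (2 ^ s) * (w η * w (ξ + η))) * (a η * G (ξ + η) ^ 2) := by
                gcongr
                rw [hw, ← ENNReal.ofReal_mul (by positivity), ← ENNReal.ofReal_mul (by positivity)]
                exact ENNReal.ofReal_le_ofReal (peetre hs ξ η)
            _ = _ := by ring
      _ = ∫⁻ η, ∫⁻ ξ, ENNReal.ofReal (2 ^ s) * ((w η * a η) * (w (ξ + η) * G (ξ + η) ^ 2)) :=
          lintegral_lintegral_swap (by fun_prop)
      _ = ∫⁻ η, ENNReal.ofReal (2 ^ s) * ((w η * a η) * HsNormSq s g) := by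
          refine lintegral_congr fun η => ?_
          rw [lintegral_const_mul' _ _ ENNReal.ofReal_ne_top, lintegral_const_mul _ (by fun_prop),
            lintegral_add_right_eq_self fun ξ => w ξ * G ξ ^ 2]
          rfl
      _ = _ := by
          rw [lintegral_const_mul' _ _ ENNReal.ofReal_ne_top, lintegral_mul_const _ (by fun_prop)]
  calc HsNormSq s (fun x => φ x * g x)
      ≤ ∫⁻ ξ, (∫⁻ η, w η * a η) * (w ξ * ∫⁻ η, a η * G (ξ + η) ^ 2) := by
        refine lintegral_mono fun ξ => ?_
        rw [← enorm_eq_nnnorm, mul_left_comm]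
        exact mul_le_mul_right (hpt ξ) _
    _ = (∫⁻ η, w η * a η) * ∫⁻ ξ, w ξ * ∫⁻ η, a η * G (ξ + η) ^ 2 := by
        refine lintegral_const_mul _ (hwm.mul ?_)
        exact Measurable.lintegral_prod_right' (f := fun p : E3 × E3 => a p.2 * G (p.1 + p.2) ^ 2)
          (by fun_prop)
    _ ≤ _ := by
        refine (mul_le_mul_right hmain _).trans_eq ?_
        ring

lemma fourier_comp_smul {c : ℝ} (hc : 0 < c) (g : E3 → ℂ) (ξ : E3) :
    𝓕 (fun x => g (c • x)) ξ = ((c ^ 3)⁻¹ : ℝ) • 𝓕 g (c⁻¹ • ξ) := by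
  have h := Measure.integral_comp_smul (volume : Measure E3)
    (fun x => 𝐞 (-inner ℝ x (c⁻¹ • ξ)) • g x) c
  rw [Real.fourier_eq, Real.fourier_eq]
  simp only [finrank_euclideanSpace_fin] at h
  rw [abs_of_pos (by positivity)] at h
  rw [← h]
  refine integral_congr_ae (ae_of_all _ fun x => ?_)
  simp only [inner_smul_left, inner_smul_right]
  congr 3
  simp [hc.ne']

lemma lintegral_comp_smul {c : ℝ} (hc : 0 < c) (F : E3 → ℝ≥0∞) :
    ∫⁻ x, F (c • x) = ENNReal.ofReal (c ^ 3)⁻¹ * ∫⁻ x, F x := by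
  have h := Measure.map_addHaar_smul (volume : Measure E3) hc.ne'
  rw [finrank_euclideanSpace_fin, abs_of_pos (by positivity)] at h
  have e : MeasurableEmbedding fun x : E3 => c • x := (Homeomorph.smulOfNeZero c hc.ne').measurableEmbedding
  rw [← e.lintegral_map, h, lintegral_smul_measure, smul_eq_mul]

/-- Dilations are bounded on `H^s`. -/
lemma HsNormSq_comp_smul_le {s c : ℝ} (hs : 0 < s) (hc : 0 < c) (g : E3 → ℂ) :
    HsNormSq s (fun x => g (c • x)) ≤
      ENNReal.ofReal ((c ^ 3)⁻¹ * (1 + c ^ 2) ^ s) * HsNormSq s g := by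
  unfold HsNormSq
  set w : E3 → ℝ≥0∞ := fun η => ENNReal.ofReal ((1 + ‖η‖ ^ 2) ^ s) with hw
  calc _ = ∫⁻ ξ, ENNReal.ofReal ((c ^ 3)⁻¹ ^ 2) * (w (c • c⁻¹ • ξ) * ‖𝓕 g (c⁻¹ • ξ)‖ₑ ^ 2) := by
        refine lintegral_congr fun ξ => ?_
        rw [smul_inv_smul₀ hc.ne', fourier_comp_smul hc, ← enorm_eq_nnnorm, enorm_smul, mul_pow,
          ENNReal.ofReal_pow (by positivity), Real.enorm_of_nonneg (by positivity)]
        ring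
    _ = ENNReal.ofReal ((c ^ 3)⁻¹) * ∫⁻ ξ, (w (c • ξ) * ‖𝓕 g ξ‖ₑ ^ 2) := by
        rw [lintegral_const_mul' _ _ ENNReal.ofReal_ne_top,
          lintegral_comp_smul (inv_pos.2 hc) fun ξ => w (c • ξ) * ‖𝓕 g ξ‖ₑ ^ 2, ← mul_assoc,
          ← ENNReal.ofReal_mul (by positivity)]
        congr 2
        field_simp
    _ ≤ ENNReal.ofReal ((c ^ 3)⁻¹) *
          ∫⁻ ξ, ENNReal.ofReal ((1 + c ^ 2) ^ s) * (w ξ * ‖𝓕 g ξ‖ₑ ^ 2) := by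
        refine mul_le_mul_right (lintegral_mono fun ξ => ?_) _
        rw [← mul_assoc]
        refine mul_le_mul_left ?_ _
        rw [hw, ← ENNReal.ofReal_mul (by positivity), ← Real.mul_rpow (by positivity)
          (by positivity)]
        refine ENNReal.ofReal_le_ofReal ?_
        gcongr
        rw [norm_smul, Real.norm_eq_abs, mul_pow, sq_abs]
        nlinarith [sq_nonneg c, sq_nonneg ‖ξ‖]
    _ = _ := by
        rw [lintegral_const_mul' _ _ ENNReal.ofReal_ne_top, ← mul_assoc,
          ← ENNReal.ofReal_mul (by positivity)]
        rfl

/-- Finite sums in `H^s`. -/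
lemma HsNormSq_sum_le {ι : Type*} (s : ℝ) (F : Finset ι) {g : ι → E3 → ℂ}
    (hg : ∀ i ∈ F, Integrable (g i)) :
    HsNormSq s (fun x => ∑ i ∈ F, g i x) ≤ F.card * ∑ i ∈ F, HsNormSq s (g i) := by
  have h1 : ∀ ξ, 𝓕 (fun x => ∑ i ∈ F, g i x) ξ = ∑ i ∈ F, 𝓕 (g i) ξ := fun ξ => by
    simp only [Real.fourier_eq, Finset.smul_sum]
    exact integral_finsetSum _ fun i hi => (Real.fourierIntegral_convergent_iff ξ).2 (hg i hi)
  have h2 : ∀ i ∈ F, Measurable fun ξ : E3 =>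
      ENNReal.ofReal ((1 + ‖ξ‖ ^ 2) ^ s) * (‖𝓕 (g i) ξ‖₊ : ℝ≥0∞) ^ 2 := fun i hi => by
    have := (continuous_fourier_of_integrable (hg i hi)).measurable
    fun_prop
  unfold HsNormSq
  rw [← lintegral_finsetSum' _ fun i hi => (h2 i hi).aemeasurable,
    ← lintegral_const_mul' _ _ (ENNReal.natCast_ne_top _)]
  refine lintegral_mono fun ξ => ?_
  rw [← Finset.mul_sum, mul_left_comm]
  gcongr
  rw [h1]
  have h3 : (‖∑ i ∈ F, 𝓕 (g i) ξ‖₊) ^ 2 ≤ F.card * ∑ i ∈ F, ‖𝓕 (g i) ξ‖₊ ^ 2 :=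
    (pow_le_pow_left₀ zero_le (nnnorm_sum_le _ _) 2).trans sq_sum_le_card_mul_sum_sq
  have h4 := ENNReal.coe_le_coe.2 h3
  push_cast at h4
  exact h4

lemma HsNormSq_congr_ae {s : ℝ} {f g : E3 → ℂ} (h : f =ᵐ[volume] g) :
    HsNormSq s f = HsNormSq s g := by
  have : 𝓕 f = 𝓕 g := by
    ext ξ
    simp only [Real.fourier_eq]
    refine integral_congr_ae ?_
    filter_upwards [h] with x hx
    rw [hx]
  rw [HsNormSq, HsNormSq, this]

/-- The weighted `L¹` norm of the Fourier transform of a test function supported in a fixed ball is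
controlled by its derivatives. -/
lemma exists_lintegral_weight_fourier_le (s : ℝ) (B : ℕ → ℝ) :
    ∃ C : ℝ≥0∞, C ≠ ⊤ ∧ ∀ φ : SchwartzMap E3 ℂ, tsupport φ ⊆ Metric.closedBall 0 2 →
      (∀ n x, ‖iteratedFDeriv ℝ n φ x‖ ≤ B n) →
      ∫⁻ η : E3, ENNReal.ofReal ((1 + ‖η‖ ^ 2) ^ s) * ‖𝓕 φ η‖ₑ ≤ C := by
  obtain ⟨N, hN⟩ := exists_nat_ge (2 * |s| + 4)
  set V : ℝ := volume.real (Metric.closedBall (0 : E3) 2)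
  set D : ℕ → ℝ := fun n => 2 ^ n * ∑ p ∈ Finset.range (n + 1), V * B p with hD
  set A : ℝ := 2 ^ N * (D 0 + D N) with hA
  refine ⟨ENNReal.ofReal A * ∫⁻ η : E3, ENNReal.ofReal ((1 + ‖η‖) ^ (-(4 : ℝ))),
    ENNReal.mul_ne_top ENNReal.ofReal_ne_top
      (finite_integral_one_add_norm (by simp; norm_num)).ne, fun φ hφ hB => ?_⟩
  have hpow : ∀ n (η : E3), ‖η‖ ^ n * ‖𝓕 φ η‖ ≤ D n := by
    intro n η
    have h := Real.pow_mul_norm_iteratedFDeriv_fourier_le (f := φ) (K := ⊤) (N := ⊤)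
      (φ.smooth ⊤) (fun k n _ _ => φ.integrable_pow_mul_iteratedFDeriv volume k n)
      (k := 0) (n := n) le_top le_top η
    rw [norm_iteratedFDeriv_zero] at h
    refine h.trans ?_
    simp only [pow_zero, one_mul, CharP.cast_eq_zero, mul_zero, zero_add, Finset.range_one,
      Finset.singleton_product, Finset.sum_map, Function.Embedding.coeFn_mk, hD]
    gcongr with p hp
    calc _ ≤ ∫ v, (Metric.closedBall (0 : E3) 2).indicator (fun _ => B p) v := by
          refine integral_mono ?_ ?_ fun v => ?_
          · simpa using φ.integrable_pow_mul_iteratedFDeriv volume 0 p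
          · exact (integrable_indicator_iff Metric.isClosed_closedBall.measurableSet).2
              (integrableOn_const (isCompact_closedBall _ _).measure_lt_top.ne)
          · by_cases hv : v ∈ Metric.closedBall (0 : E3) 2
            · rw [indicator_of_mem hv]
              exact hB p v
            · rw [indicator_of_notMem hv]
              have : v ∉ tsupport (iteratedFDeriv ℝ p φ) := fun h =>
                hv (hφ (tsupport_iteratedFDeriv_subset p h))
              simp [image_eq_zero_of_notMem_tsupport this]
      _ = _ := by
          rw [integral_indicator Metric.isClosed_closedBall.measurableSet, setIntegral_const,
            smul_eq_mul]
  have hpt : ∀ η : E3, (1 + ‖η‖ ^ 2) ^ s * ‖𝓕 φ η‖ ≤ A * (1 + ‖η‖) ^ (-(4 : ℝ)) := by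
    intro η
    have h1 : (1 + ‖η‖ ^ 2) ^ s ≤ (1 + ‖η‖) ^ N * (1 + ‖η‖) ^ (-(4 : ℝ)) := by
      have hη := norm_nonneg η
      calc (1 + ‖η‖ ^ 2) ^ s ≤ (1 + ‖η‖ ^ 2) ^ |s| :=
            Real.rpow_le_rpow_of_exponent_le (by nlinarith) (le_abs_self s)
        _ ≤ ((1 + ‖η‖) ^ (2 : ℝ)) ^ |s| := by
            gcongr
            rw [Real.rpow_two]
            nlinarith
        _ = (1 + ‖η‖) ^ (2 * |s|) := by rw [Real.rpow_mul (by positivity)]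
        _ ≤ (1 + ‖η‖) ^ ((N : ℝ) + -4) :=
            Real.rpow_le_rpow_of_exponent_le (by linarith) (by linarith)
        _ = _ := by rw [Real.rpow_add (by positivity), Real.rpow_natCast]
    have h2 : (1 + ‖η‖) ^ N ≤ 2 ^ N * (1 + ‖η‖ ^ N) := by
      have h0 : 1 + ‖η‖ ≤ 2 * max 1 ‖η‖ := by
        linarith [le_max_left 1 ‖η‖, le_max_right 1 ‖η‖]
      calc _ ≤ (2 * max 1 ‖η‖) ^ N := by gcongr
        _ = 2 ^ N * (max 1 ‖η‖) ^ N := mul_pow _ _ _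
        _ ≤ _ := by
            gcongr
            rcases max_cases 1 ‖η‖ with ⟨h, _⟩ | ⟨h, _⟩ <;> rw [h]
            · simp
            · linarith
    calc _ ≤ (2 ^ N * (1 + ‖η‖ ^ N)) * (1 + ‖η‖) ^ (-(4 : ℝ)) * ‖𝓕 φ η‖ := by
          gcongr
          exact h1.trans (by gcongr)
      _ = 2 ^ N * (‖η‖ ^ 0 * ‖𝓕 φ η‖ + ‖η‖ ^ N * ‖𝓕 φ η‖) * (1 + ‖η‖) ^ (-(4 : ℝ)) := by ring
      _ ≤ _ := by
          rw [hA]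
          gcongr
          · exact hpow 0 η
          · exact hpow N η
  rw [← lintegral_const_mul' _ _ ENNReal.ofReal_ne_top]
  refine lintegral_mono fun η => ?_
  rw [← ofReal_norm, ← ENNReal.ofReal_mul (by positivity),
    ← ENNReal.ofReal_mul' (by positivity)]
  exact ENNReal.ofReal_le_ofReal (hpt η)

/-- Uniform bound for multiplication by smooth functions supported in a fixed ball. -/
lemma exists_HsNormSq_smooth_mul_le {s : ℝ} (hs : 0 < s) (B : ℕ → ℝ) :
    ∃ C : ℝ≥0∞, C ≠ ⊤ ∧ ∀ φ : E3 → ℝ, ContDiff ℝ (⊤ : ℕ∞) φ → (∀ x, φ x ≠ 0 → ‖x‖ ≤ 2) →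
      (∀ n x, ‖iteratedFDeriv ℝ n φ x‖ ≤ B n) → ∀ g : E3 → ℂ, Integrable g →
      HsNormSq s (fun x => φ x * g x) ≤ C * HsNormSq s g := by
  obtain ⟨C, hC, h⟩ := exists_lintegral_weight_fourier_le s B
  refine ⟨ENNReal.ofReal (2 ^ s) * C ^ 2, ENNReal.mul_ne_top ENNReal.ofReal_ne_top
    (ENNReal.pow_ne_top hC), fun φ hφ hsupp hB g hg => ?_⟩
  set Φ : E3 → ℂ := fun x => (φ x : ℂ) with hΦ
  have hΦs : ContDiff ℝ (⊤ : ℕ∞) Φ := Complex.ofRealCLM.contDiff.comp hφ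
  have hΦt : tsupport Φ ⊆ Metric.closedBall 0 2 := by
    refine closure_minimal (fun x hx => ?_) Metric.isClosed_closedBall
    rw [mem_closedBall_zero_iff]
    exact hsupp x fun h0 => hx (by simp [hΦ, h0])
  have hΦc : HasCompactSupport Φ :=
    (isCompact_closedBall (0 : E3) 2).of_isClosed_subset (isClosed_tsupport Φ) hΦt
  refine (HsNormSq_mul_le hs (hΦc.toSchwartzMap hΦs) hg).trans ?_
  gcongr
  refine h _ hΦt fun n x => ?_
  refine le_of_eq_of_le ?_ (hB n x)
  exact Complex.ofRealLI.norm_iteratedFDeriv_comp_left (f := φ) (n := (n : ℕ∞))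
    ((hφ.of_le (by exact_mod_cast le_top)).contDiffAt) le_rfl

/-- A family of functions with uniformly bounded derivatives of each order. -/
def UnifBddDerivs {ι : Type*} (F : ι → E3 → ℝ) : Prop :=
  ∀ n : ℕ, ∃ C : ℝ, 0 ≤ C ∧ ∀ i x, ‖iteratedFDeriv ℝ n (F i) x‖ ≤ C

lemma UnifBddDerivs.mul {ι : Type*} {F G : ι → E3 → ℝ} (hF : UnifBddDerivs F)
    (hG : UnifBddDerivs G) (hFs : ∀ i, ContDiff ℝ (⊤ : ℕ∞) (F i))
    (hGs : ∀ i, ContDiff ℝ (⊤ : ℕ∞) (G i)) : UnifBddDerivs fun i x => F i x * G i x := by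
  choose a ha0 ha using hF
  choose b hb0 hb using hG
  intro n
  refine ⟨∑ k ∈ Finset.range (n + 1), (n.choose k : ℝ) * a k * b (n - k),
    Finset.sum_nonneg fun k _ => mul_nonneg (mul_nonneg (by positivity) (ha0 k)) (hb0 _),
    fun i x => ?_⟩
  refine (norm_iteratedFDeriv_mul_le (hFs i) (hGs i) x (n := n) (by exact_mod_cast le_top)).trans ?_
  refine Finset.sum_le_sum fun k _ => ?_
  have := ha0 k
  gcongr
  · exact ha k i x
  · exact hb _ i x

lemma UnifBddDerivs.comp {ι : Type*} {F : ι → E3 → ℝ} (hF : UnifBddDerivs F)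
    (hFs : ∀ i, ContDiff ℝ (⊤ : ℕ∞) (F i)) {g : ℝ → ℝ} (hg : ContDiff ℝ (⊤ : ℕ∞) g) :
    UnifBddDerivs fun i x => g (F i x) := by
  choose a ha0 ha using hF
  intro n
  have hcpt : IsCompact (Metric.closedBall (0 : ℝ) (a 0)) := isCompact_closedBall _ _
  have hb : ∀ m : ℕ, ∃ C : ℝ, ∀ t ∈ Metric.closedBall (0 : ℝ) (a 0),
      ‖iteratedFDeriv ℝ m g t‖ ≤ C := fun m =>
    hcpt.exists_bound_of_continuousOn
      (hg.continuous_iteratedFDeriv (by exact_mod_cast le_top)).continuousOn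
  choose b hb using hb
  set C : ℝ := ∑ m ∈ Finset.range (n + 1), |b m| with hC
  set D : ℝ := 1 + ∑ m ∈ Finset.range (n + 1), a m with hD
  have hD1 : 1 ≤ D := by
    have := Finset.sum_nonneg fun m (_ : m ∈ Finset.range (n + 1)) => ha0 m
    linarith
  have hC0 : 0 ≤ C := Finset.sum_nonneg fun m _ => abs_nonneg _
  refine ⟨n.factorial * C * D ^ n, by positivity, fun i x => ?_⟩
  refine norm_iteratedFDeriv_comp_le hg (hFs i) (n := n) (by exact_mod_cast le_top) x
    (fun m hm => ?_) fun m hm1 hm => ?_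
  · have hmem : F i x ∈ Metric.closedBall (0 : ℝ) (a 0) := by
      rw [mem_closedBall_zero_iff, ← norm_iteratedFDeriv_zero (𝕜 := ℝ) (f := F i)]
      exact ha 0 i x
    exact ((hb m _ hmem).trans (le_abs_self _)).trans
      (Finset.single_le_sum (f := fun m => |b m|) (fun m _ => abs_nonneg _)
        (Finset.mem_range_succ_iff.2 hm))
  · have h1 : a m ≤ D := by
      have := Finset.single_le_sum (f := a) (fun m _ => ha0 m) (Finset.mem_range_succ_iff.2 hm)
      linarith
    exact ((ha m i x).trans h1).trans (le_self_pow₀ hD1 (by omega))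

namespace DyadicPartition

variable (P : DyadicPartition)

/-- The sum of the cut-offs adjacent to `ψ j`, rescaled to unit size. -/
def nbhd (j : ℕ) (x : E3) : ℝ := ∑ k ∈ Finset.Icc (j - 1) (j + 1), P.ψ k ((2 : ℝ) ^ j • x)

lemma contDiff_ψ_smul (k : ℕ) (c : ℝ) : ContDiff ℝ (⊤ : ℕ∞) fun x => P.ψ k (c • x) :=
  (P.smooth k).comp (contDiff_const_smul c)

lemma contDiff_nbhd (j : ℕ) : ContDiff ℝ (⊤ : ℕ∞) (P.nbhd j) :=
  ContDiff.sum fun k _ => P.contDiff_ψ_smul k _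

lemma card_Icc_le (j : ℕ) : (Finset.Icc (j - 1) (j + 1)).card ≤ 3 := by
  rw [Nat.card_Icc]; omega

lemma exists_norm_iteratedFDeriv_ψ_smul_le (n : ℕ) : ∃ C : ℝ, 0 ≤ C ∧
    ∀ j, ∀ k ∈ Finset.Icc (j - 1) (j + 1), ∀ x,
      ‖iteratedFDeriv ℝ n (fun x => P.ψ k ((2 : ℝ) ^ j • x)) x‖ ≤ C := by
  obtain ⟨C, hC⟩ := P.deriv_bound n
  refine ⟨|C| * 2 ^ n, by positivity, fun j k hk x => ?_⟩
  rw [iteratedFDeriv_comp_const_smul _ ((P.smooth k).of_le (by exact_mod_cast le_top)), norm_smul]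
  have h1 : ‖((2 : ℝ) ^ j) ^ n‖ = (2 : ℝ) ^ ((n : ℤ) * j) := by
    rw [Real.norm_of_nonneg (by positivity), ← pow_mul, mul_comm j n]
    exact_mod_cast rfl
  rw [h1]
  rw [Finset.mem_Icc] at hk
  calc _ ≤ (2 : ℝ) ^ ((n : ℤ) * j) * (|C| * 2 ^ (-(n : ℤ) * (k : ℤ))) := by
        gcongr
        exact (hC k _).trans (by gcongr; exact le_abs_self C)
    _ = |C| * (2 : ℝ) ^ ((n : ℤ) * j + -(n : ℤ) * (k : ℤ)) := by
        rw [zpow_add₀ two_ne_zero]; ring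
    _ ≤ |C| * (2 : ℝ) ^ (n : ℤ) := by
        gcongr
        · norm_num
        · have : (j : ℤ) ≤ k + 1 := by omega
          nlinarith [Int.natCast_nonneg n]
    _ = _ := by rw [zpow_natCast]

lemma unifBddDerivs_ψ : UnifBddDerivs fun (j : ℕ) x => P.ψ j ((2 : ℝ) ^ j • x) := fun n => by
  obtain ⟨C, h0, hC⟩ := P.exists_norm_iteratedFDeriv_ψ_smul_le n
  exact ⟨C, h0, fun j x => hC j j (by simp) x⟩

lemma unifBddDerivs_nbhd : UnifBddDerivs P.nbhd := fun n => by
  obtain ⟨C, h0, hC⟩ := P.exists_norm_iteratedFDeriv_ψ_smul_le n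
  refine ⟨3 * C, by positivity, fun j x => ?_⟩
  have h : P.nbhd j = fun x => ∑ k ∈ Finset.Icc (j - 1) (j + 1), P.ψ k ((2 : ℝ) ^ j • x) := rfl
  rw [h, iteratedFDeriv_sum fun k _ =>
    (P.contDiff_ψ_smul k _).of_le (by exact_mod_cast le_top)]
  rw [Finset.sum_apply]
  refine (norm_sum_le_of_le _ fun k hk => hC j k hk x).trans ?_
  rw [Finset.sum_const, nsmul_eq_mul]
  gcongr
  exact_mod_cast card_Icc_le j

lemma one_le_nbhd {j : ℕ} {x : E3} (hx : P.ψ j ((2 : ℝ) ^ j • x) ≠ 0) : 1 ≤ P.nbhd j x := by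
  set y : E3 := (2 : ℝ) ^ j • x with hy
  have key : ∀ k ∈ Finset.Icc (j - 1) (j + 1), P.ψ k y = 1 → 1 ≤ P.nbhd j x := fun k hk h => by
    rw [← h]
    exact Finset.single_le_sum (f := fun k => P.ψ k y) (fun k _ => P.nonneg k y) hk
  rcases Nat.eq_zero_or_pos j with rfl | hj
  · have h2 := P.supp_zero y hx
    rcases le_total ‖y‖ 1 with h | h
    · exact key 0 (by simp) (P.one_zero y h)
    · exact key 1 (by simp) (P.one_succ 1 le_rfl y (by simpa using h) (by simpa using h2))
  · obtain ⟨h1, h2⟩ := P.supp_succ j hj y hx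
    rcases le_total ‖y‖ ((2 : ℝ) ^ ((j : ℤ) - 1)) with h | h
    · rcases Nat.lt_or_ge 1 j with hj1 | hj1
      · refine key (j - 1) (by simp; omega) (P.one_succ (j - 1) (by omega) y ?_ ?_)
        · rwa [show ((j - 1 : ℕ) : ℤ) - 1 = (j : ℤ) - 2 by omega]
        · rwa [show ((j - 1 : ℕ) : ℤ) = (j : ℤ) - 1 by omega]
      · obtain rfl : j = 1 := by omega
        exact key 0 (by simp) (P.one_zero y (by simpa using h))
    · rcases le_total ‖y‖ ((2 : ℝ) ^ (j : ℤ)) with h' | h'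
      · exact key j (by simp) (P.one_succ j hj y h h')
      · refine key (j + 1) (by simp; omega) (P.one_succ (j + 1) (by omega) y ?_ ?_)
        · rwa [show ((j + 1 : ℕ) : ℤ) - 1 = (j : ℤ) by omega]
        · rwa [show ((j + 1 : ℕ) : ℤ) = (j : ℤ) + 1 by omega]

end DyadicPartition

/-- A smooth function on the line that agrees with `t ^ (-β)` for `t ≥ 1`. -/
lemma exists_smooth_eq_rpow_neg (β : ℝ) :
    ∃ G : ℝ → ℝ, ContDiff ℝ (⊤ : ℕ∞) G ∧ ∀ t, 1 ≤ t → G t = t ^ (-β) := by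
  set q : ℝ → ℝ := fun t => 1 + Real.smoothTransition t * (t - 1) with hq
  have hqs : ContDiff ℝ (⊤ : ℕ∞) q :=
    contDiff_const.add (Real.smoothTransition.contDiff.mul (contDiff_id.sub contDiff_const))
  have hpos : ∀ t, 0 < q t := fun t => by
    rcases le_or_gt t 0 with h | h
    · simp [hq, Real.smoothTransition.zero_of_nonpos h]
    · have h0 := Real.smoothTransition.nonneg t
      have h1 := Real.smoothTransition.le_one t
      rcases le_or_gt t 1 with h2 | h2
      · have : Real.smoothTransition t * (1 - t) ≤ 1 * (1 - t) := by
          gcongr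
        simp only [hq]
        linarith
      · have := mul_nonneg h0 (sub_nonneg.2 h2.le)
        simp only [hq]
        linarith
  refine ⟨fun t => q t ^ (-β), hqs.rpow_const_of_ne fun t => (hpos t).ne', fun t ht => ?_⟩
  simp [hq, Real.smoothTransition.one_of_one_le ht]

lemma memLp_mul_of_hasCompactSupport {a w : E3 → ℝ} {M : ℝ} (ha : Continuous a)
    (hc : HasCompactSupport a) (hw : Measurable w) (hM : ∀ x, |w x| ≤ M) (p : ℝ≥0∞) :
    MemLp (fun x => a x * w x) p := by
  refine MemLp.of_le_mul (c := M) (ha.memLp_of_hasCompactSupport hc (p := p) (μ := volume))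
    (by fun_prop) (ae_of_all _ fun x => ?_)
  rw [norm_mul, mul_comm]
  gcongr
  exact hM x

namespace DyadicPartition

variable (P : DyadicPartition)

lemma HsNormSq_ψ_smul_le {s : ℝ} (hs : 0 < s) (v : E3 → ℝ) {j k : ℕ}
    (hk : k ∈ Finset.Icc (j - 1) (j + 1)) :
    HsNormSq s (fun x => ((P.ψ k ((2 : ℝ) ^ j • x) * v ((2 : ℝ) ^ j • x) : ℝ) : ℂ)) ≤
      ENNReal.ofReal (8 * 5 ^ s) *
        HsNormSq s (fun x => ((P.ψ k ((2 : ℝ) ^ k • x) * v ((2 : ℝ) ^ k • x) : ℝ) : ℂ)) := by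
  rw [Finset.mem_Icc] at hk
  set c : ℝ := (2 : ℝ) ^ ((j : ℤ) - k) with hc
  have hc0 : 0 < c := by positivity
  have hck : ∀ x : E3, (2 : ℝ) ^ k • c • x = (2 : ℝ) ^ j • x := fun x => by
    rw [smul_smul, hc, ← zpow_natCast, ← zpow_natCast, ← zpow_add₀ two_ne_zero]
    congr 2
    omega
  have h1 : c ≤ 2 := by
    calc c ≤ (2 : ℝ) ^ (1 : ℤ) := zpow_le_zpow_right₀ one_le_two (by omega)
      _ = 2 := by norm_num
  have h2 : 1 / 2 ≤ c := by
    calc (1 / 2 : ℝ) = (2 : ℝ) ^ (-1 : ℤ) := by norm_num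
      _ ≤ c := zpow_le_zpow_right₀ one_le_two (by omega)
  have h := HsNormSq_comp_smul_le hs hc0
    fun x => ((P.ψ k ((2 : ℝ) ^ k • x) * v ((2 : ℝ) ^ k • x) : ℝ) : ℂ)
  simp only [hck] at h
  refine h.trans (mul_le_mul_left (ENNReal.ofReal_le_ofReal ?_) _)
  gcongr
  · rw [inv_le_comm₀ (by positivity) (by norm_num)]
    calc (8 : ℝ)⁻¹ = (1 / 2) ^ 3 := by norm_num
      _ ≤ c ^ 3 := by gcongr
  · nlinarith

/-- The dyadic blocks of `|v| ^ β` are controlled by the adjacent dyadic blocks of `v`. -/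
lemma exists_HsNormSq_block_le {s M β : ℝ} (hs : 0 < s) (hβ : 1 < β) (hsβ : s < β + 1 / 2)
    (hM : 0 ≤ M) : ∃ C : ℝ≥0∞, C ≠ ⊤ ∧ ∀ v : E3 → ℝ, Measurable v → (∀ x, |v x| ≤ M) → ∀ j : ℕ,
      HsNormSq s (fun x => ((P.ψ j ((2 : ℝ) ^ j • x) * |v ((2 : ℝ) ^ j • x)| ^ β : ℝ) : ℂ)) ≤
        C * ∑ k ∈ Finset.Icc (j - 1) (j + 1),
          HsNormSq s (fun x => ((P.ψ k ((2 : ℝ) ^ k • x) * v ((2 : ℝ) ^ k • x) : ℝ) : ℂ)) := by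
  obtain ⟨G, hGs, hG⟩ := exists_smooth_eq_rpow_neg β
  have hφb : UnifBddDerivs fun (j : ℕ) x => P.ψ j ((2 : ℝ) ^ j • x) * G (P.nbhd j x) :=
    P.unifBddDerivs_ψ.mul (P.unifBddDerivs_nbhd.comp P.contDiff_nbhd hGs)
      (fun j => P.contDiff_ψ_smul j _) fun j => hGs.comp (P.contDiff_nbhd j)
  choose B hB0 hB using hφb
  obtain ⟨a, ha0, ha⟩ := P.unifBddDerivs_nbhd 0
  obtain ⟨C₁, hC₁, hmul⟩ := exists_HsNormSq_smooth_mul_le hs B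
  obtain ⟨C₂, hC₂, hpow⟩ := exists_HsNormSq_abs_rpow_le hs hβ hsβ (mul_nonneg ha0 hM)
  refine ⟨C₁ * (C₂ * (3 * ENNReal.ofReal (8 * 5 ^ s))), by finiteness, fun v hv hvM j => ?_⟩
  set f : E3 → ℝ := fun x => P.nbhd j x * v ((2 : ℝ) ^ j • x) with hf
  have hfsum : f = fun x => ∑ k ∈ Finset.Icc (j - 1) (j + 1),
      P.ψ k ((2 : ℝ) ^ j • x) * v ((2 : ℝ) ^ j • x) := by
    ext x
    simp only [hf, nbhd, Finset.sum_mul]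
  have hvj : Measurable fun x : E3 => v ((2 : ℝ) ^ j • x) := hv.comp (measurable_const_smul _)
  have hLp : ∀ (p : ℝ≥0∞) k, MemLp (fun x => P.ψ k ((2 : ℝ) ^ j • x) * v ((2 : ℝ) ^ j • x)) p :=
    fun p k => memLp_mul_of_hasCompactSupport (P.contDiff_ψ_smul k _).continuous
      ((P.compSupp k).comp_smul (by positivity)) hvj (fun x => hvM _) p
  have hfLp : ∀ p : ℝ≥0∞, MemLp f p := fun p => by
    rw [hfsum]
    exact memLp_finsetSum _ fun k _ => hLp p k
  have hfm : Measurable f := (P.contDiff_nbhd j).continuous.measurable.mul hvj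
  have hfM : ∀ x, |f x| ≤ a * M := fun x => by
    rw [hf, abs_mul]
    gcongr
    · have := ha j x
      rwa [norm_iteratedFDeriv_zero, Real.norm_eq_abs] at this
    · exact hvM _
  have hfi : Integrable f := memLp_one_iff_integrable.1 (hfLp 1)
  have hpowi : Integrable fun x => ((|f x| ^ β : ℝ) : ℂ) := by
    refine Integrable.ofReal (f := fun x => |f x| ^ β)
      (Integrable.mono' (hfi.abs.const_mul ((a * M) ^ (β - 1))) ?_ (ae_of_all _ fun x => ?_))
    · exact (by fun_prop : Measurable fun x => |f x| ^ β).aestronglyMeasurable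
    · rw [Real.norm_of_nonneg (Real.rpow_nonneg (abs_nonneg _) _)]
      exact abs_rpow_le_mul_abs hβ (hfM x)
  have hid : (fun x => ((P.ψ j ((2 : ℝ) ^ j • x) * |v ((2 : ℝ) ^ j • x)| ^ β : ℝ) : ℂ)) =
      fun x => ((P.ψ j ((2 : ℝ) ^ j • x) * G (P.nbhd j x) : ℝ) : ℂ) * ((|f x| ^ β : ℝ) : ℂ) := by
    ext x
    rw [← Complex.ofReal_mul]
    congr 1
    by_cases h0 : P.ψ j ((2 : ℝ) ^ j • x) = 0
    · simp [h0]
    · have h1 := P.one_le_nbhd h0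
      have hp : 0 < P.nbhd j x := by linarith
      rw [hG _ h1, hf, abs_mul, abs_of_pos hp, Real.mul_rpow hp.le (abs_nonneg _),
        Real.rpow_neg hp.le]
      field_simp
  have hsupp : ∀ x, P.ψ j ((2 : ℝ) ^ j • x) * G (P.nbhd j x) ≠ 0 → ‖x‖ ≤ 2 := by
    intro x hx
    have h0 := left_ne_zero_of_mul hx
    rcases Nat.eq_zero_or_pos j with rfl | hj
    · simpa using P.supp_zero _ h0
    · have h2 := (P.supp_succ j hj _ h0).2
      rw [norm_smul, Real.norm_of_nonneg (by positivity), zpow_add₀ two_ne_zero, zpow_natCast,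
        zpow_one] at h2
      exact le_of_mul_le_mul_left h2 (by positivity)
  rw [hid]
  calc _ ≤ C₁ * HsNormSq s fun x => ((|f x| ^ β : ℝ) : ℂ) :=
        hmul _ ((P.contDiff_ψ_smul j _).mul (hGs.comp (P.contDiff_nbhd j))) hsupp
          (fun n x => hB n j x) _ hpowi
    _ ≤ C₁ * (C₂ * HsNormSq s fun x => (f x : ℂ)) :=
        mul_le_mul_right (hpow f hfm hfM hfi (hfLp 2)) _
    _ ≤ C₁ * (C₂ * (3 * ∑ k ∈ Finset.Icc (j - 1) (j + 1), ENNReal.ofReal (8 * 5 ^ s) *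
          HsNormSq s (fun x => ((P.ψ k ((2 : ℝ) ^ k • x) * v ((2 : ℝ) ^ k • x) : ℝ) : ℂ)))) := by
        gcongr
        have hsum := HsNormSq_sum_le s (Finset.Icc (j - 1) (j + 1))
          (g := fun k x => ((P.ψ k ((2 : ℝ) ^ j • x) * v ((2 : ℝ) ^ j • x) : ℝ) : ℂ))
          fun k _ => (memLp_one_iff_integrable.1 (hLp 1 k)).ofReal
        simp only [← Complex.ofReal_sum] at hsum
        rw [hfsum]
        refine hsum.trans ?_
        gcongr with k hk
        · exact_mod_cast card_Icc_le j
        · exact P.HsNormSq_ψ_smul_le hs v hk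
    _ = _ := by
        rw [← Finset.mul_sum]
        ring

end DyadicPartition

/-- Summation over adjacent indices. -/
lemma tsum_sum_Icc_le (a : ℕ → ℝ≥0∞) :
    ∑' j : ℕ, ∑ k ∈ Finset.Icc (j - 1) (j + 1), a k ≤ 4 * ∑' j, a j := by
  have h : ∀ j : ℕ, ∑ k ∈ Finset.Icc (j - 1) (j + 1), a k ≤ a (j - 1) + a j + a (j + 1) := by
    intro j
    have hsub : Finset.Icc (j - 1) (j + 1) ⊆ {j - 1, j, j + 1} := by
      intro k hk
      simp only [Finset.mem_Icc, Finset.mem_insert, Finset.mem_singleton] at hk ⊢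
      omega
    refine (Finset.sum_le_sum_of_subset hsub).trans ?_
    have hins : ∀ (i : ℕ) (S : Finset ℕ), ∑ k ∈ insert i S, a k ≤ a i + ∑ k ∈ S, a k := by
      intro i S
      by_cases hi : i ∈ S
      · rw [Finset.insert_eq_of_mem hi]
        exact le_add_self
      · rw [Finset.sum_insert hi]
    rw [add_assoc]
    refine (hins _ _).trans (add_le_add_right ((hins _ _).trans ?_) _)
    rw [Finset.sum_singleton]
  calc _ ≤ ∑' j, (a (j - 1) + a j + a (j + 1)) := ENNReal.tsum_le_tsum h
    _ = ∑' j, a (j - 1) + ∑' j, a j + ∑' j, a (j + 1) := by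
        rw [ENNReal.tsum_add, ENNReal.tsum_add]
    _ ≤ (∑' j, a j + ∑' j, a j) + ∑' j, a j + ∑' j, a j := by
        gcongr ?_ + _ + ?_
        · rw [tsum_eq_zero_add' ENNReal.summable]
          gcongr
          · exact ENNReal.le_tsum 0
          · simp
        · exact ENNReal.tsum_comp_le_tsum_of_injective (add_left_injective 1) a
    _ = _ := by ring

lemma exists_HwNormSq_abs_rpow_le (P : DyadicPartition) {s M β : ℝ} (δ : ℝ) (hs : 0 < s)
    (hβ : 1 < β) (hsβ : s < β + 1 / 2) (hM : 0 ≤ M) :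
    ∃ C : ℝ≥0∞, C ≠ ⊤ ∧ ∀ v : E3 → ℝ, Measurable v → (∀ x, |v x| ≤ M) →
      HwNormSq P s δ (fun x => |v x| ^ β) ≤ C * HwNormSq P s δ v := by
  obtain ⟨C, hC, h⟩ := P.exists_HsNormSq_block_le hs hβ hsβ hM
  refine ⟨C * (ENNReal.ofReal (2 ^ |3 + 2 * δ|) * 4), by finiteness, fun v hv hvM => ?_⟩
  set w : ℕ → ℝ≥0∞ := fun j => ENNReal.ofReal ((2 : ℝ) ^ ((3 + 2 * δ) * (j : ℝ))) with hw
  set b : ℕ → ℝ≥0∞ := fun k =>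
    HsNormSq s (fun x => ((P.ψ k ((2 : ℝ) ^ k • x) * v ((2 : ℝ) ^ k • x) : ℝ) : ℂ)) with hb
  have hwle : ∀ j, ∀ k ∈ Finset.Icc (j - 1) (j + 1),
      w j ≤ ENNReal.ofReal (2 ^ |3 + 2 * δ|) * w k := by
    intro j k hk
    rw [Finset.mem_Icc] at hk
    rw [hw, ← ENNReal.ofReal_mul (by positivity), ← Real.rpow_add two_pos]
    refine ENNReal.ofReal_le_ofReal (Real.rpow_le_rpow_of_exponent_le one_le_two ?_)
    have h1 : (j : ℝ) ≤ k + 1 := by exact_mod_cast (by omega : j ≤ k + 1)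
    have h2 : (k : ℝ) ≤ j + 1 := by exact_mod_cast hk.2
    have h3 : |(j : ℝ) - k| ≤ 1 := abs_le.2 ⟨by linarith, by linarith⟩
    have h4 : (3 + 2 * δ) * ((j : ℝ) - k) ≤ |3 + 2 * δ| * 1 :=
      (le_abs_self _).trans ((abs_mul _ _).trans_le (mul_le_mul_of_nonneg_left h3 (abs_nonneg _)))
    linarith
  calc HwNormSq P s δ (fun x => |v x| ^ β)
      ≤ ∑' j, C * (ENNReal.ofReal (2 ^ |3 + 2 * δ|) *
          ∑ k ∈ Finset.Icc (j - 1) (j + 1), w k * b k) := by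
        refine ENNReal.tsum_le_tsum fun j => ?_
        refine (mul_le_mul_right (h v hv hvM j) _).trans ?_
        rw [mul_left_comm]
        refine mul_le_mul_right ?_ _
        rw [Finset.mul_sum, Finset.mul_sum]
        refine Finset.sum_le_sum fun k hk => ?_
        rw [← mul_assoc]
        exact mul_le_mul_left (hwle j k hk) _
    _ ≤ C * (ENNReal.ofReal (2 ^ |3 + 2 * δ|) * (4 * ∑' j, w j * b j)) := by
        rw [ENNReal.tsum_mul_left, ENNReal.tsum_mul_left]
        gcongr
        exact tsum_sum_Icc_le _
    _ = _ := by
        rw [HwNormSq]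
        ring

lemma HwNormSq_congr_ae (P : DyadicPartition) (s δ : ℝ) {u v : E3 → ℝ} (h : u =ᵐ[volume] v) :
    HwNormSq P s δ u = HwNormSq P s δ v := by
  refine tsum_congr fun j => ?_
  congr 1
  refine HsNormSq_congr_ae ?_
  have hq : Measure.QuasiMeasurePreserving (fun x : E3 => (2 : ℝ) ^ j • x) volume volume :=
    Measure.quasiMeasurePreserving_smul volume (by positivity)
  filter_upwards [hq.ae_eq_comp h] with x hx
  simp only [Function.comp_apply] at hx
  rw [hx]

/-- Kateb's estimate in the weighted spaces.
Let `β > 1`, `0 < s < β + 1/2`, `δ ∈ ℝ` and `M > 0`. Then there is a constant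
`C = C(s,δ,β,M)` such that every `u ∈ H_{s,δ} ∩ L^∞` with `‖u‖_{L^∞} ≤ M` satisfies
`|u|^β ∈ H_{s,δ}` and `‖|u|^β‖_{H_{s,δ}} ≤ C ‖u‖_{H_{s,δ}}`. -/
theorem kateb_estimate (P : DyadicPartition) (s δ β M : ℝ)
    (hβ : 1 < β) (hs : 0 < s) (hs' : s < β + 1/2) (hM : 0 < M) :
    ∃ C : ℝ, 0 < C ∧ ∀ u : E3 → ℝ,
      MemH P s δ u → (∀ x, |u x| ≤ M) →
      MemH P s δ (fun x => |u x| ^ β) ∧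
      Hnorm P s δ (fun x => |u x| ^ β) ≤ C * Hnorm P s δ u := by
  obtain ⟨C, hC, h⟩ := exists_HwNormSq_abs_rpow_le P δ hs hβ hs' hM.le
  refine ⟨√C.toReal + 1, by positivity, fun u hu huM => ?_⟩
  obtain ⟨hui, hun⟩ := hu
  obtain ⟨v₀, hv₀, huv₀⟩ : AEStronglyMeasurable u volume := hui.aestronglyMeasurable
  set v : E3 → ℝ := fun x => max (-M) (min M (v₀ x)) with hv
  have hvm : Measurable v := by
    have := hv₀.measurable
    fun_prop
  have hvM : ∀ x, |v x| ≤ M := fun x => by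
    rw [hv, abs_le]
    exact ⟨le_max_left _ _, max_le (by linarith) (min_le_left _ _)⟩
  have huv : u =ᵐ[volume] v := by
    filter_upwards [huv₀] with x hx
    have := abs_le.1 (huM x)
    simp only [hv, ← hx, min_eq_right this.2, max_eq_right this.1]
  have hpuv : (fun x => |u x| ^ β) =ᵐ[volume] fun x => |v x| ^ β := by
    filter_upwards [huv] with x hx
    rw [hx]
  have hle : HwNormSq P s δ (fun x => |u x| ^ β) ≤ C * HwNormSq P s δ u := by
    rw [HwNormSq_congr_ae P s δ huv, HwNormSq_congr_ae P s δ hpuv]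
    exact h v hvm hvM
  have htop : C * HwNormSq P s δ u ≠ ⊤ := ENNReal.mul_ne_top hC hun.ne
  refine ⟨⟨?_, hle.trans_lt htop.lt_top⟩, ?_⟩
  · refine (hui.smul (M ^ (β - 1))).mono ?_ (ae_of_all _ fun x => ?_)
    · exact ((by fun_prop : Measurable fun x => |v x| ^ β).aestronglyMeasurable).congr hpuv.symm
    · rw [Real.norm_of_nonneg (by positivity)]
      refine (abs_rpow_le_mul_abs hβ (huM x)).trans_eq ?_
      rw [Pi.smul_apply, norm_smul, Real.norm_of_nonneg (by positivity), Real.norm_eq_abs]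
  · rw [Hnorm, Hnorm]
    calc _ ≤ √(C * HwNormSq P s δ u).toReal :=
          Real.sqrt_le_sqrt (ENNReal.toReal_mono htop hle)
      _ = √C.toReal * √(HwNormSq P s δ u).toReal := by
          rw [ENNReal.toReal_mul, Real.sqrt_mul ENNReal.toReal_nonneg]
      _ ≤ _ := by
          gcongr
          linarith
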